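/- arXiv:2504.16248 — 4 statements merged into one kernel-verified Lean document; each statement's English description precedes it below -/
import Mathlib

section
/- The submodule of Λ²M fixed pointwise by Λ²g is free of rank 4 with basis (μ₁₃ − μ₂₄, μ₁₄ + μ₂₃ − μ₂₄, μ₁₂, μ₃₄); moreover, with respect to this basis, the Gram matrix of three times the pairing ⟨·,·⟩ is [[6,3,0,0],[3,6,0,0],[0,0,0,3],[0,0,3,0]]. -/
noncomputable section

/-- The free ℤ-module `M = ℤ⁴` with basis `(μ₁, μ₂, μ₃, μ₄)`. -/
abbrev M4 : Type := Fin 4 → ℤ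

/-- The matrix of the order-3 automorphism `g` of `M`:
`g(μ₁) = −μ₂`, `g(μ₂) = μ₁ − μ₂`, `g(μ₃) = −μ₃ + μ₄`, `g(μ₄) = −μ₃`. -/
def gMat : Matrix (Fin 4) (Fin 4) ℤ :=
  !![0, 1, 0, 0; -1, -1, 0, 0; 0, 0, -1, -1; 0, 0, 1, 0]

/-- The automorphism `g : M → M`. -/
def gLin : M4 →ₗ[ℤ] M4 := Matrix.toLin' gMat

/-- The basis vectors `μ_j`, viewed inside the exterior algebra of `M`. -/
def mu (i : Fin 4) : ExteriorAlgebra ℤ M4 :=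
  ExteriorAlgebra.ι ℤ (Pi.single i 1 : M4)

/-- `μ_{jk} := μ_j ∧ μ_k`. -/
def muw (j k : Fin 4) : ExteriorAlgebra ℤ M4 := mu j * mu k

/-- The exterior square `Λ²M`, the free ℤ-module with basis `μ_{jk}`, `j < k`. -/
def Lambda2 : Submodule ℤ (ExteriorAlgebra ℤ M4) :=
  Submodule.span ℤ {x | ∃ j k : Fin 4, j < k ∧ x = muw j k}

/-- The algebra map induced by `g` on the exterior algebra; its restriction to `Λ²M`
is `Λ²g`. -/
def Gmap : ExteriorAlgebra ℤ M4 →ₐ[ℤ] ExteriorAlgebra ℤ M4 := ExteriorAlgebra.map gLin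

/-- The generator `μ₁∧μ₂∧μ₃∧μ₄` of `Λ⁴M`. -/
def vol : ExteriorAlgebra ℤ M4 := mu 0 * mu 1 * mu 2 * mu 3

/-- The claimed basis `(μ₁₃ − μ₂₄, μ₁₄ + μ₂₃ − μ₂₄, μ₁₂, μ₃₄)` of the fixed submodule. -/
def fixedBasis : Fin 4 → ExteriorAlgebra ℤ M4 :=
  ![muw 0 2 - muw 1 3, muw 0 3 + muw 1 2 - muw 1 3, muw 0 1, muw 2 3]

/-- The Gram matrix of three times the pairing `⟨·,·⟩`. -/
def gram3 : Matrix (Fin 4) (Fin 4) ℤ :=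
  !![6, 3, 0, 0; 3, 6, 0, 0; 0, 0, 0, 3; 0, 0, 3, 0]

lemma mu_sq (i : Fin 4) : mu i * mu i = 0 := ExteriorAlgebra.ι_sq_zero _

lemma mu_sq' (i : Fin 4) (x : ExteriorAlgebra ℤ M4) : mu i * (mu i * x) = 0 := by
  rw [← mul_assoc, mu_sq, zero_mul]

lemma mu_sw (i j : Fin 4) (_h : j < i) : mu i * mu j = - (mu j * mu i) :=
  eq_neg_of_add_eq_zero_left (ExteriorAlgebra.ι_add_mul_swap _ _)

lemma mu_sw' (i j : Fin 4) (h : j < i) (x : ExteriorAlgebra ℤ M4) :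
    mu i * (mu j * x) = - (mu j * (mu i * x)) := by
  rw [← mul_assoc, mu_sw i j h, neg_mul, mul_assoc]

lemma G0 : Gmap (mu 0) = - mu 1 := by
  rw [Gmap, mu, mu, ExteriorAlgebra.map_apply_ι, ← map_neg]
  congr 1
  ext i
  fin_cases i <;> simp [gLin, gMat, Matrix.toLin'_apply]

lemma G1 : Gmap (mu 1) = mu 0 - mu 1 := by
  rw [Gmap, mu, mu, ExteriorAlgebra.map_apply_ι, ← map_sub]
  congr 1
  ext i
  fin_cases i <;> simp [gLin, gMat, Matrix.toLin'_apply]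

lemma G2 : Gmap (mu 2) = - mu 2 + mu 3 := by
  rw [Gmap, mu, mu, ExteriorAlgebra.map_apply_ι, ← map_neg, ← map_add]
  congr 1
  ext i
  fin_cases i <;> simp [gLin, gMat, Matrix.toLin'_apply]

lemma G3 : Gmap (mu 3) = - mu 2 := by
  rw [Gmap, mu, mu, ExteriorAlgebra.map_apply_ι, ← map_neg]
  congr 1
  ext i
  fin_cases i <;> simp [gLin, gMat, Matrix.toLin'_apply]

/-- Coefficient functional. -/
def cf (j k : Fin 4) : ExteriorAlgebra ℤ M4 →ₗ[ℤ] ℤ :=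
  ExteriorAlgebra.liftAlternating (R := ℤ) (M := M4) (N := ℤ)
    (Pi.single 2 ((Matrix.detRowAlternating (n := Fin 2) (R := ℤ)).compLinearMap
      (LinearMap.funLeft ℤ ℤ ![j, k])))

lemma cf_mul (j k a b : Fin 4) : cf j k (mu a * mu b) =
    (Pi.single a 1 : M4) j * (Pi.single b 1 : M4) k
      - (Pi.single a 1 : M4) k * (Pi.single b 1 : M4) j := by
  have h : mu a * mu b = ExteriorAlgebra.ιMulti ℤ 2 ![(Pi.single a 1 : M4), Pi.single b 1] := by
    simp [ExteriorAlgebra.ιMulti_apply, mu]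
  rw [h, cf, ExteriorAlgebra.liftAlternating_apply_ιMulti]
  simp only [Pi.single_eq_same]
  change Matrix.det (R := ℤ) (n := Fin 2) _ = _
  refine (Matrix.det_fin_two _).trans ?_
  change (Pi.single a 1 : M4) j * (Pi.single b 1 : M4) k
      - (Pi.single a 1 : M4) k * (Pi.single b 1 : M4) j = _
  rfl

lemma mem_L (x : ExteriorAlgebra ℤ M4) (hx : x ∈ Lambda2) : ∃ a b c d e f : ℤ,
    x = a • muw 0 1 + b • muw 0 2 + c • muw 0 3 + d • muw 1 2 + e • muw 1 3 + f • muw 2 3 := by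
  induction hx using Submodule.span_induction with
  | mem x h =>
    obtain ⟨j, k, hjk, rfl⟩ := h
    fin_cases j <;> fin_cases k <;> first | (exfalso; revert hjk; decide) | skip
    · exact ⟨1, 0, 0, 0, 0, 0, by simp⟩
    · exact ⟨0, 1, 0, 0, 0, 0, by simp⟩
    · exact ⟨0, 0, 1, 0, 0, 0, by simp⟩
    · exact ⟨0, 0, 0, 1, 0, 0, by simp⟩
    · exact ⟨0, 0, 0, 0, 1, 0, by simp⟩
    · exact ⟨0, 0, 0, 0, 0, 1, by simp⟩
  | zero => exact ⟨0, 0, 0, 0, 0, 0, by simp⟩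
  | add x y _ _ hx hy =>
    obtain ⟨a, b, c, d, e, f, rfl⟩ := hx
    obtain ⟨a', b', c', d', e', f', rfl⟩ := hy
    exact ⟨a + a', b + b', c + c', d + d', e + e', f + f', by module⟩
  | smul r x _ hx =>
    obtain ⟨a, b, c, d, e, f, rfl⟩ := hx
    exact ⟨r * a, r * b, r * c, r * d, r * e, r * f, by module⟩

lemma L_mem (j k : Fin 4) (h : j < k) : muw j k ∈ Lambda2 :=
  Submodule.subset_span ⟨j, k, h, rfl⟩

lemma Gw01 : Gmap (muw 0 1) = muw 0 1 := by
  simp [muw, G0, G1, mul_sub, mu_sq, mu_sw 1 0 (by decide)]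
lemma Gw23 : Gmap (muw 2 3) = muw 2 3 := by
  simp [muw, G2, G3, add_mul, mu_sq, mu_sw 3 2 (by decide)]
lemma Gw02 : Gmap (muw 0 2) = muw 1 2 - muw 1 3 := by
  simp only [muw, G0, G2, map_mul]; noncomm_ring
lemma Gw03 : Gmap (muw 0 3) = muw 1 2 := by
  simp only [muw, G0, G3, map_mul]; noncomm_ring
lemma Gw12 : Gmap (muw 1 2) = - muw 0 2 + muw 0 3 + muw 1 2 - muw 1 3 := by
  simp only [muw, G1, G2, map_mul]; noncomm_ring
lemma Gw13 : Gmap (muw 1 3) = - muw 0 2 + muw 1 2 := by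
  simp only [muw, G1, G3, map_mul]; noncomm_ring

theorem statement1 :
    -- the submodule of Λ²M fixed pointwise by Λ²g is free of rank 4 with basis `fixedBasis`
    ({x : ExteriorAlgebra ℤ M4 | x ∈ Lambda2 ∧ Gmap x = x} =
      (Submodule.span ℤ (Set.range fixedBasis) : Set (ExteriorAlgebra ℤ M4))) ∧
    LinearIndependent ℤ fixedBasis ∧
    -- with respect to this basis, the Gram matrix of three times the pairing
    -- (defined by `a ∧ b = ⟨a,b⟩ · μ₁∧μ₂∧μ₃∧μ₄`) is `gram3`
    (∃ m : Fin 4 → Fin 4 → ℤ,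
      (∀ i j : Fin 4, fixedBasis i * fixedBasis j = m i j • vol) ∧
      (∀ i j : Fin 4, 3 * m i j = gram3 i j)) := by
  refine ⟨?_, ?_, ?_⟩
  · ext x
    constructor
    · rintro ⟨hx, hg⟩
      obtain ⟨a, b, c, d, e, f, rfl⟩ := mem_L x hx
      simp only [map_add, map_zsmul, Gw01, Gw02, Gw03, Gw12, Gw13, Gw23] at hg
      have h02 := congrArg (cf 0 2) hg
      have h03 := congrArg (cf 0 3) hg
      have h12 := congrArg (cf 1 2) hg
      have h13 := congrArg (cf 1 3) hg
      simp [muw, cf_mul, -zsmul_eq_mul] at h02 h03 h12 h13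
      have hd : d = c := by omega
      have he : e = - b - c := by omega
      subst hd he
      have e0 : muw 0 2 - muw 1 3 ∈ Submodule.span ℤ (Set.range fixedBasis) :=
        Submodule.subset_span ⟨0, rfl⟩
      have e1 : muw 0 3 + muw 1 2 - muw 1 3 ∈ Submodule.span ℤ (Set.range fixedBasis) :=
        Submodule.subset_span ⟨1, rfl⟩
      have e2 : muw 0 1 ∈ Submodule.span ℤ (Set.range fixedBasis) :=
        Submodule.subset_span ⟨2, rfl⟩
      have e3 : muw 2 3 ∈ Submodule.span ℤ (Set.range fixedBasis) :=
        Submodule.subset_span ⟨3, rfl⟩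
      have := add_mem (add_mem (Submodule.smul_mem _ b e0) (Submodule.smul_mem _ d e1))
        (add_mem (Submodule.smul_mem _ a e2) (Submodule.smul_mem _ f e3))
      rw [SetLike.mem_coe]
      convert this using 1
      module
    · intro hx
      have h01 := L_mem 0 1 (by decide)
      have h02 := L_mem 0 2 (by decide)
      have h03 := L_mem 0 3 (by decide)
      have h12 := L_mem 1 2 (by decide)
      have h13 := L_mem 1 3 (by decide)
      have h23 := L_mem 2 3 (by decide)
      rw [SetLike.mem_coe] at hx
      change x ∈ Lambda2 ∧ Gmap x = x
      induction hx using Submodule.span_induction with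
      | mem x h =>
        obtain ⟨i, rfl⟩ := h
        fin_cases i
        · refine ⟨sub_mem h02 h13, ?_⟩
          simp only [fixedBasis, Fin.zero_eta, Matrix.cons_val_zero, map_sub, Gw02, Gw13]
          abel
        · refine ⟨sub_mem (add_mem h03 h12) h13, ?_⟩
          simp only [fixedBasis, Fin.mk_one, Matrix.cons_val_one, Matrix.cons_val_zero, map_sub,
            map_add, Gw03, Gw12, Gw13]
          abel
        · exact ⟨h01, Gw01⟩
        · exact ⟨h23, Gw23⟩
      | zero => exact ⟨zero_mem _, map_zero _⟩
      | add x y _ _ hx hy => exact ⟨add_mem hx.1 hy.1, by rw [map_add, hx.2, hy.2]⟩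
      | smul r x _ hx => exact ⟨Submodule.smul_mem _ _ hx.1, by rw [map_zsmul, hx.2]⟩
  · rw [Fintype.linearIndependent_iff]
    intro g hg
    have h02 := congrArg (cf 0 2) hg
    have h03 := congrArg (cf 0 3) hg
    have h01 := congrArg (cf 0 1) hg
    have h23 := congrArg (cf 2 3) hg
    simp [Fin.sum_univ_four, fixedBasis, muw, cf_mul, -zsmul_eq_mul] at h02 h03 h01 h23
    intro i
    fin_cases i <;> assumption
  · refine ⟨!![2, 1, 0, 0; 1, 2, 0, 0; 0, 0, 0, 1; 0, 0, 1, 0], ?_, ?_⟩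
    · intro i j
      fin_cases i <;> fin_cases j <;>
        simp [-zsmul_eq_mul, fixedBasis, muw, vol, mul_sub, sub_mul, mul_add, add_mul, mul_assoc, mu_sq, mu_sq',
          mu_sw 2 1 (by decide), mu_sw 3 1 (by decide), mu_sw 3 2 (by decide),
          mu_sw' 1 0 (by decide), mu_sw' 2 0 (by decide), mu_sw' 3 0 (by decide),
          mu_sw' 2 1 (by decide), mu_sw' 3 1 (by decide), mu_sw' 3 2 (by decide)] <;>
        abel
    · intro i j
      fin_cases i <;> fin_cases j <;> simp [gram3]
end
end

section
/- The vectors k₁, k₂, k₃ lie in the dual lattice K*; the discriminant group K*/K is isomorphic to (ℤ/3)³ and is generated by k₁ + K, k₂ + K, k₃ + K; the bilinear form on the discriminant group is diagonal with respect to these generators, i.e. b_K(k_i + K, k_j + K) = 0 in ℚ/ℤ for i ≠ j, and the discriminant form takes the values q_K(k_j + K) = −2/3 mod 2ℤ for j = 1, 2, 3. -/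
noncomputable section

abbrev VK : Type := Fin 4 → ℚ

/-- The basis `(κ₁, κ₂, κ₃, κ₄)` of `K`. -/
def kappa (i : Fin 4) : VK := Pi.single i 1

/-- The Gram matrix of the bilinear form on `K`. -/
def GK : Matrix (Fin 4) (Fin 4) ℚ := !![2, 1, 0, 0; 1, 2, 0, 0; 0, 0, 0, 3; 0, 0, 3, 0]

/-- The symmetric bilinear form on `K ⊗ ℚ`. -/
def BK (x y : VK) : ℚ := ∑ i : Fin 4, ∑ j : Fin 4, x i * GK i j * y j

lemma BK_add_left (a b x : VK) : BK (a + b) x = BK a x + BK b x := by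
  simp only [BK, Pi.add_apply, add_mul, Finset.sum_add_distrib]

lemma BK_zsmul_left (c : ℤ) (a x : VK) : BK (c • a) x = c * BK a x := by
  simp only [BK, Pi.smul_apply, zsmul_eq_mul, Finset.mul_sum, mul_assoc]

lemma BK_zero_left (x : VK) : BK 0 x = 0 := by
  simp [BK]

/-- The lattice `K = ℤκ₁ ⊕ ℤκ₂ ⊕ ℤκ₃ ⊕ ℤκ₄`. -/
def Klat : Submodule ℤ VK := Submodule.span ℤ (Set.range kappa)

/-- The dual lattice `Λ* = {v | ⟨v,λ⟩ ∈ ℤ for all λ ∈ Λ}`. -/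
def dualK (Λ : Submodule ℤ VK) : Submodule ℤ VK where
  carrier := {v | ∀ x ∈ Λ, ∃ n : ℤ, BK v x = n}
  zero_mem' := fun x _ => ⟨0, by simp [BK_zero_left]⟩
  add_mem' := by
    intro a b ha hb x hx
    obtain ⟨n, hn⟩ := ha x hx
    obtain ⟨m, hm⟩ := hb x hx
    exact ⟨n + m, by rw [BK_add_left, hn, hm]; push_cast; ring⟩
  smul_mem' := by
    intro c v hv x hx
    obtain ⟨n, hn⟩ := hv x hx
    exact ⟨c * n, by rw [BK_zsmul_left, hn]; push_cast; ring⟩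

/-- `k₁ := (1/3)(2κ₁ − κ₂ + κ₃ + κ₄)`. -/
def k1 : VK := (3 : ℚ)⁻¹ • (2 • kappa 0 - kappa 1 + kappa 2 + kappa 3)

/-- `k₂ := (1/3)(κ₃ − κ₄)`. -/
def k2 : VK := (3 : ℚ)⁻¹ • (kappa 2 - kappa 3)

/-- `k₃ := (1/3)(2κ₁ − κ₂ − κ₃ − κ₄)`. -/
def k3 : VK := (3 : ℚ)⁻¹ • (2 • kappa 0 - kappa 1 - kappa 2 - kappa 3)

def kv : Fin 3 → VK := ![k1, k2, k3]

lemma memK_iff (v : VK) : v ∈ Klat ↔ ∀ i, ∃ n : ℤ, v i = n := by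
  constructor
  · intro h
    unfold Klat at h
    induction h using Submodule.span_induction with
    | mem x hx =>
      obtain ⟨j, rfl⟩ := hx
      intro i
      by_cases hij : i = j
      · subst hij; exact ⟨1, by simp [kappa]⟩
      · exact ⟨0, by simp [kappa, hij]⟩
    | zero => intro i; exact ⟨0, by simp⟩
    | add x y _ _ hx hy =>
      intro i
      obtain ⟨n, hn⟩ := hx i
      obtain ⟨m, hm⟩ := hy i
      exact ⟨n + m, by simp [hn, hm]⟩
    | smul c x _ hx =>
      intro i
      obtain ⟨n, hn⟩ := hx i
      exact ⟨c * n, by simp [hn]⟩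
  · intro h
    choose n hn using h
    have : v = ∑ i, n i • kappa i := by
      ext j
      simp [kappa, Finset.sum_apply, Pi.single_apply, hn]
    rw [this]
    exact Submodule.sum_mem _ fun i _ =>
      Submodule.smul_mem _ _ (Submodule.subset_span ⟨i, rfl⟩)

lemma BK_eq (x y : VK) : BK x y = 2 * x 0 * y 0 + x 0 * y 1 + x 1 * y 0 + 2 * x 1 * y 1
    + 3 * x 2 * y 3 + 3 * x 3 * y 2 := by
  simp [BK, GK, Fin.sum_univ_four]
  ring

lemma mem_dual_iff (v : VK) : v ∈ dualK Klat ↔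
    (∃ n : ℤ, 2 * v 0 + v 1 = n) ∧ (∃ n : ℤ, v 0 + 2 * v 1 = n) ∧
    (∃ n : ℤ, 3 * v 3 = n) ∧ (∃ n : ℤ, 3 * v 2 = n) := by
  constructor
  · intro h
    have key : ∀ i, ∃ n : ℤ, BK v (kappa i) = n :=
      fun i => h _ (Submodule.subset_span ⟨i, rfl⟩)
    have h0 := key 0
    have h1 := key 1
    have h2 := key 2
    have h3 := key 3
    simp [BK_eq, kappa] at h0 h1 h2 h3
    refine ⟨h0, ?_, h2, h3⟩
    simpa using h1
  · rintro ⟨⟨a, ha⟩, ⟨b, hb⟩, ⟨c, hc⟩, ⟨d, hd⟩⟩ x hx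
    rw [memK_iff] at hx
    choose n hn using hx
    refine ⟨a * n 0 + b * n 1 + c * n 2 + d * n 3, ?_⟩
    rw [BK_eq]
    push_cast
    rw [← ha, ← hb, ← hc, ← hd, hn, hn, hn, hn]
    ring

lemma k1_eq : k1 = ![2/3, -1/3, 1/3, 1/3] := by
  ext i; fin_cases i <;> simp [k1, kappa] <;> norm_num

lemma k2_eq : k2 = ![0, 0, 1/3, -1/3] := by
  ext i; fin_cases i <;> simp [k2, kappa] <;> norm_num

lemma k3_eq : k3 = ![2/3, -1/3, -1/3, -1/3] := by
  ext i; fin_cases i <;> simp [k3, kappa] <;> norm_num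

lemma comb_mem (a b c : ℤ) : a • k1 + b • k2 + c • k3 ∈ dualK Klat := by
  rw [mem_dual_iff]
  simp only [k1_eq, k2_eq, k3_eq]
  refine ⟨⟨a + c, ?_⟩, ⟨0, ?_⟩, ⟨a - b - c, ?_⟩, ⟨a + b - c, ?_⟩⟩ <;> simp <;> ring

lemma dual_comb (v : VK) (h : v ∈ dualK Klat) :
    ∃ a b c : ℤ, a • k1 + b • k2 + c • k3 - v ∈ Klat := by
  rw [mem_dual_iff] at h
  obtain ⟨⟨p, hp⟩, ⟨q, hq⟩, ⟨s, hs⟩, ⟨r, hr⟩⟩ := h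
  refine ⟨-(p + q - r - s), s - r, -(p + q + r + s), ?_⟩
  rw [memK_iff]
  have e0 : v 0 = (2 * p - q) / 3 := by rw [← hp, ← hq]; ring
  have e1 : v 1 = (2 * q - p) / 3 := by rw [← hp, ← hq]; ring
  have e2 : v 2 = r / 3 := by rw [← hr]; ring
  have e3 : v 3 = s / 3 := by rw [← hs]; ring
  simp only [k1_eq, k2_eq, k3_eq]
  rw [Fin.forall_fin_succ, Fin.forall_fin_succ, Fin.forall_fin_succ, Fin.forall_fin_succ]
  refine ⟨⟨-2 * p - q, ?_⟩, ⟨p, ?_⟩, ⟨s, ?_⟩, ⟨r, ?_⟩, fun i => i.elim0⟩ <;>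
    simp [e0, e1, e2, e3] <;> ring

lemma comb_mem_K (a b c : ℤ) (h : a • k1 + b • k2 + c • k3 ∈ Klat) :
    (3 : ℤ) ∣ a ∧ (3 : ℤ) ∣ b ∧ (3 : ℤ) ∣ c := by
  rw [memK_iff] at h
  obtain ⟨n1, h1⟩ := h 1
  obtain ⟨n2, h2⟩ := h 2
  obtain ⟨n3, h3⟩ := h 3
  simp [k1_eq, k2_eq, k3_eq] at h1 h2 h3
  have e1 : -(a + c) = 3 * n1 := by
    have : (-(a + c) : ℚ) = 3 * n1 := by rw [← h1]; ring
    exact_mod_cast this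
  have e2 : a + b - c = 3 * n2 := by
    have : (a + b - c : ℚ) = 3 * n2 := by rw [← h2]; ring
    exact_mod_cast this
  have e3 : a - b - c = 3 * n3 := by
    have : (a - b - c : ℚ) = 3 * n3 := by rw [← h3]; ring
    exact_mod_cast this
  omega

lemma three_smul_K (v : VK) (h : ∀ i, ∃ n : ℤ, 3 * v i = n) : (3 : ℤ) • Klat.mkQ v = 0 := by
  rw [← map_smul, Submodule.mkQ_apply, Submodule.Quotient.mk_eq_zero, memK_iff]
  intro i
  obtain ⟨n, hn⟩ := h i
  exact ⟨n, by simpa using hn⟩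

/-- the map `ℤ/3 → V/K` given by a 3-torsion class -/
def zlift (x : VK ⧸ Klat) (h : (3 : ℤ) • x = 0) : ZMod 3 →+ VK ⧸ Klat :=
  ZMod.lift 3 ⟨zmultiplesHom _ x, by simpa using h⟩

lemma zlift_coe (x : VK ⧸ Klat) (h : (3 : ℤ) • x = 0) (a : ℤ) :
    zlift x h (a : ZMod 3) = a • x := by
  simp [zlift]

lemma disc_equiv :
    Nonempty ((Submodule.map Klat.mkQ (dualK Klat)) ≃+ (ZMod 3 × ZMod 3 × ZMod 3)) := by
  have t1 : (3 : ℤ) • Klat.mkQ k1 = 0 := by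
    apply three_smul_K
    simp only [k1_eq, Fin.forall_fin_succ]
    refine ⟨⟨2, ?_⟩, ⟨-1, ?_⟩, ⟨1, ?_⟩, ⟨1, ?_⟩, fun i => i.elim0⟩ <;> simp <;> norm_num
  have t2 : (3 : ℤ) • Klat.mkQ k2 = 0 := by
    apply three_smul_K
    simp only [k2_eq, Fin.forall_fin_succ]
    refine ⟨⟨0, ?_⟩, ⟨0, ?_⟩, ⟨1, ?_⟩, ⟨-1, ?_⟩, fun i => i.elim0⟩ <;> simp <;> norm_num
  have t3 : (3 : ℤ) • Klat.mkQ k3 = 0 := by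
    apply three_smul_K
    simp only [k3_eq, Fin.forall_fin_succ]
    refine ⟨⟨2, ?_⟩, ⟨-1, ?_⟩, ⟨-1, ?_⟩, ⟨-1, ?_⟩, fun i => i.elim0⟩ <;> simp <;> norm_num
  let φ : ZMod 3 × ZMod 3 × ZMod 3 →+ VK ⧸ Klat :=
    (zlift _ t1).coprod ((zlift _ t2).coprod (zlift _ t3))
  have hφ : ∀ a b c : ℤ, φ ((a : ZMod 3), (b : ZMod 3), (c : ZMod 3)) =
      Klat.mkQ (a • k1 + b • k2 + c • k3) := by
    intro a b c
    simp only [φ, AddMonoidHom.coprod_apply, zlift_coe, map_add, map_smul, add_assoc]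
  have hmem : ∀ z, φ z ∈ (Submodule.map Klat.mkQ (dualK Klat)).toAddSubgroup := by
    rintro ⟨a, b, c⟩
    obtain ⟨a, rfl⟩ := ZMod.intCast_surjective a
    obtain ⟨b, rfl⟩ := ZMod.intCast_surjective b
    obtain ⟨c, rfl⟩ := ZMod.intCast_surjective c
    rw [hφ]
    exact Submodule.mem_map_of_mem (comb_mem a b c)
  refine ⟨(AddEquiv.ofBijective (φ.codRestrict _ hmem) ⟨?_, ?_⟩).symm⟩
  · rw [injective_iff_map_eq_zero]
    rintro ⟨a, b, c⟩ h
    obtain ⟨a, rfl⟩ := ZMod.intCast_surjective a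
    obtain ⟨b, rfl⟩ := ZMod.intCast_surjective b
    obtain ⟨c, rfl⟩ := ZMod.intCast_surjective c
    have h' : φ ((a : ZMod 3), (b : ZMod 3), (c : ZMod 3)) = 0 := congrArg Subtype.val h
    rw [hφ, Submodule.mkQ_apply, Submodule.Quotient.mk_eq_zero] at h'
    obtain ⟨ha, hb, hc⟩ := comb_mem_K a b c h'
    have e := fun x : ℤ => ZMod.intCast_zmod_eq_zero_iff_dvd x 3
    rw [(e a).2 ha, (e b).2 hb, (e c).2 hc]
    rfl
  · rintro ⟨x, v, hv, rfl⟩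
    obtain ⟨a, b, c, h⟩ := dual_comb v hv
    refine ⟨((a : ZMod 3), (b : ZMod 3), (c : ZMod 3)), Subtype.ext ?_⟩
    change φ _ = _
    rw [hφ]
    exact (Submodule.Quotient.eq Klat).2 h

theorem statement5 :
    -- k₁, k₂, k₃ lie in the dual lattice K*
    (∀ j : Fin 3, kv j ∈ dualK Klat) ∧
    -- the discriminant group K*/K is generated by k₁+K, k₂+K, k₃+K ...
    (Submodule.map Klat.mkQ (dualK Klat) =
      Submodule.span ℤ {Klat.mkQ k1, Klat.mkQ k2, Klat.mkQ k3}) ∧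
    -- ... and is isomorphic to (ℤ/3)³
    Nonempty ((Submodule.map Klat.mkQ (dualK Klat)) ≃+ (ZMod 3 × ZMod 3 × ZMod 3)) ∧
    -- the bilinear form on the discriminant group is diagonal w.r.t. these generators
    (∀ i j : Fin 3, i ≠ j → ∃ n : ℤ, BK (kv i) (kv j) = n) ∧
    -- and q_K(k_j + K) = −2/3 mod 2ℤ
    (∀ j : Fin 3, ∃ n : ℤ, BK (kv j) (kv j) = -2 / 3 + 2 * n) := by
  have hk : ∀ j : Fin 3, kv j ∈ dualK Klat := by
    intro j
    fin_cases j
    · simpa [kv] using comb_mem 1 0 0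
    · simpa [kv] using comb_mem 0 1 0
    · simpa [kv] using comb_mem 0 0 1
  refine ⟨hk, ?_, disc_equiv, ?_, ?_⟩
  · apply le_antisymm
    · rintro _ ⟨v, hv, rfl⟩
      obtain ⟨a, b, c, h⟩ := dual_comb v hv
      have : Klat.mkQ v = Klat.mkQ (a • k1 + b • k2 + c • k3) :=
        ((Submodule.Quotient.eq Klat).2 h).symm
      rw [this, Submodule.mem_span_triple]
      exact ⟨a, b, c, by simp only [map_add, map_smul]⟩
    · rw [Submodule.span_le]
      rintro _ (rfl | rfl | rfl)
      · exact Submodule.mem_map_of_mem (hk 0)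
      · exact Submodule.mem_map_of_mem (hk 1)
      · exact Submodule.mem_map_of_mem (hk 2)
  · intro i j hij
    refine ⟨0, ?_⟩
    fin_cases i <;> fin_cases j <;> first
      | exact absurd rfl hij
      | (simp [kv, BK_eq, k1_eq, k2_eq, k3_eq]; try norm_num)
  · intro j
    fin_cases j
    · exact ⟨1, by simp [kv, BK_eq, k1_eq]; norm_num⟩
    · exact ⟨0, by simp [kv, BK_eq, k2_eq]; norm_num⟩
    · exact ⟨1, by simp [kv, BK_eq, k3_eq]; norm_num⟩
end
end

section
/- The ℚ-linear maps α¹, α², β of (K ⊕ P)⊗ℚ defined by α¹(κ_i) = α²(κ_i) = κ_i for all i, α¹(E^(j)_{(t₁,t₂)}) = E^(j)_{(t₁+1,t₂)}, α²(E^(j)_{(t₁,t₂)}) = E^(j)_{(t₁,t₂+1)}, and β(κ₁) = κ₁, β(κ₂) = κ₂, β(κ₃) = κ₄, β(κ₄) = κ₃, β(E^(j)_{(t₁,t₂)}) = E^(3−j)_{(−t₂,t₁)} (indices in 𝔽₃, j ∈ {1,2}), all preserve the bilinear form and map the glued lattice Γ onto itself; moreover, the subgroup of the automorphism group of Γ generated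 by α¹, α², β has order 36 and is isomorphic to (ℤ/3 × ℤ/3) ⋊ ℤ/4, where the generator of ℤ/4 acts on ℤ/3 × ℤ/3 by (a,b) ↦ (−b,a). -/
noncomputable section

abbrev F3 : Type := ZMod 3 × ZMod 3
abbrev IP : Type := F3 × Fin 2
abbrev VP : Type := IP → ℚ

/-- The basis vectors `E_t^(k)` (with `k : Fin 2` corresponding to `k+1 ∈ {1,2}`). -/
def Ev (t : F3) (k : Fin 2) : VP := Pi.single (t, k) 1

/-- Gram coefficients of the bilinear form on `V`. -/
def GP : IP → IP → ℚ := fun i j =>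
  if i.1 = j.1 then (if i.2 = j.2 then -2 else 1) else 0

/-- The symmetric bilinear form on `V`. -/
def BP (x y : VP) : ℚ := ∑ i : IP, ∑ j : IP, x i * GP i j * y j

lemma BP_add_left (a b x : VP) : BP (a + b) x = BP a x + BP b x := by
  simp only [BP, Pi.add_apply, add_mul, Finset.sum_add_distrib]

lemma BP_zsmul_left (c : ℤ) (a x : VP) : BP (c • a) x = c * BP a x := by
  simp only [BP, Pi.smul_apply, zsmul_eq_mul, Finset.mul_sum, mul_assoc]

lemma BP_zero_left (x : VP) : BP 0 x = 0 := by
  simp [BP]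

/-- `E_t := E_t^(1) + 2·E_t^(2)`. -/
def EV (t : F3) : VP := Ev t 0 + 2 • Ev t 1

/-- The affine line in `𝔽₃²` through `p` with direction `d`. -/
def lineF (p d : F3) : Finset F3 := Finset.image (fun s : ZMod 3 => p + s • d) Finset.univ

def IsLine (L : Finset F3) : Prop := ∃ p d : F3, d ≠ 0 ∧ L = lineF p d

def AreParallel (L L' : Finset F3) : Prop :=
  ∃ p p' d : F3, d ≠ 0 ∧ L = lineF p d ∧ L' = lineF p' d

/-- `e(L) := (1/3)·∑_{t∈L} E_t`. -/
def eL (L : Finset F3) : VP := (3 : ℚ)⁻¹ • ∑ t ∈ L, EV t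

/-- Generators of the root lattice `R` of type `A₂⁹`. -/
def Rgen : Set VP := {x | ∃ t k, x = Ev t k}

/-- The root lattice `R`. -/
def Rlat : Submodule ℤ VP := Submodule.span ℤ Rgen

/-- The lattice `P`. -/
def Plat : Submodule ℤ VP :=
  Submodule.span ℤ (Rgen ∪ {x | ∃ L L', AreParallel L L' ∧ x = eL L - eL L'})

/-- The dual lattice `Λ* = {v | ⟨v,λ⟩ ∈ ℤ for all λ ∈ Λ}`. -/
def dualP (Λ : Submodule ℤ VP) : Submodule ℤ VP where
  carrier := {v | ∀ x ∈ Λ, ∃ n : ℤ, BP v x = n}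
  zero_mem' := fun x _ => ⟨0, by simp [BP_zero_left]⟩
  add_mem' := by
    intro a b ha hb x hx
    obtain ⟨n, hn⟩ := ha x hx
    obtain ⟨m, hm⟩ := hb x hx
    exact ⟨n + m, by rw [BP_add_left, hn, hm]; push_cast; ring⟩
  smul_mem' := by
    intro c v hv x hx
    obtain ⟨n, hn⟩ := hv x hx
    exact ⟨c * n, by rw [BP_zsmul_left, hn]; push_cast; ring⟩

def L12 : Finset F3 := lineF (0, 0) (0, 1)
def L34 : Finset F3 := lineF (0, 0) (1, 0)
def L00 : Finset F3 := lineF (0, 0) (1, 1)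

def p1 : VP := eL L34 + eL L00
def p2 : VP := eL L12 + eL L34
def p3 : VP := eL L12 + eL L00

def pv : Fin 3 → VP := ![p1, p2, p3]


/-- The bilinear form on `(K ⊕ P) ⊗ ℚ`. -/
def Bf (v w : VK × VP) : ℚ := BK v.1 w.1 + BP v.2 w.2

/-- The discriminant group `K*/K`, realized as the image of `K*` in `(K⊗ℚ)/K`. -/
def DK : Submodule ℤ (VK ⧸ Klat) := Submodule.map Klat.mkQ (dualK Klat)

/-- The discriminant group `P*/P`, realized as the image of `P*` in `(P⊗ℚ)/P`. -/
def DP : Submodule ℤ (VP ⧸ Plat) := Submodule.map Plat.mkQ (dualP Plat)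


/-- Translation by `(1,0)` on `𝔽₃²`. -/
def T1 : Equiv.Perm F3 := Equiv.addLeft ((1, 0) : F3)

/-- Translation by `(0,1)` on `𝔽₃²`. -/
def T2 : Equiv.Perm F3 := Equiv.addLeft ((0, 1) : F3)

/-- The order-4 map `(a,b) ↦ (−b,a)` on `𝔽₃²`. -/
def JPerm : Equiv.Perm F3 :=
  ⟨fun p => (-p.2, p.1), fun p => (p.2, -p.1), fun p => by simp, fun p => by simp⟩

/-- A concrete model of the semidirect product `(ℤ/3 × ℤ/3) ⋊ ℤ/4`, where the generator of
`ℤ/4` acts on `ℤ/3 × ℤ/3` by `(a,b) ↦ (−b,a)`: the permutation group of `𝔽₃²` generated by the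
translations `T1`, `T2` (generating `ℤ/3 × ℤ/3`) and the order-4 map `JPerm`, whose conjugation
action on the translation subgroup is exactly `(a,b) ↦ (−b,a)`. -/
def ModelGroup : Subgroup (Equiv.Perm F3) := Subgroup.closure {T1, T2, JPerm}


abbrev QG : Type := Equiv.Perm (Fin 4) × Equiv.Perm F3 × Equiv.Perm (Fin 2)

def pIP (q : QG) : Equiv.Perm IP := Equiv.prodCongr q.2.1 q.2.2

def rho : QG →* ((VK × VP) ≃ₗ[ℚ] (VK × VP)) where
  toFun q := LinearEquiv.prodCongr (LinearEquiv.funCongrLeft ℚ ℚ q.1.symm)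
    (LinearEquiv.funCongrLeft ℚ ℚ (pIP q).symm)
  map_one' := by
    ext v <;> rfl
  map_mul' a b := by
    ext v <;> rfl

lemma rho_fst (q : QG) (v : VK × VP) (i : Fin 4) : (rho q v).1 i = v.1 (q.1.symm i) := rfl
lemma rho_snd (q : QG) (v : VK × VP) (i : IP) : (rho q v).2 i = v.2 ((pIP q).symm i) := rfl

def aK (q : QG) : VK →ₗ[ℚ] VK := (LinearEquiv.funCongrLeft ℚ ℚ q.1.symm).toLinearMap
def aP (q : QG) : VP →ₗ[ℚ] VP := (LinearEquiv.funCongrLeft ℚ ℚ (pIP q).symm).toLinearMap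

lemma rho_apply (q : QG) (v : VK × VP) : rho q v = (aK q v.1, aP q v.2) := rfl

lemma aK_mul (q r : QG) (x : VK) : aK (q * r) x = aK q (aK r x) := rfl
lemma aP_mul (q r : QG) (x : VP) : aP (q * r) x = aP q (aP r x) := rfl
lemma aK_one (x : VK) : aK 1 x = x := rfl
lemma aP_one (x : VP) : aP 1 x = x := rfl

lemma aK_kappa (q : QG) (i : Fin 4) : aK q (kappa i) = kappa (q.1 i) := by
  ext j
  change kappa i (q.1.symm j) = _
  simp only [kappa, Pi.single_apply]
  congr 1
  simp [Equiv.symm_apply_eq]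

lemma aP_Ev (q : QG) (t : F3) (k : Fin 2) : aP q (Ev t k) = Ev (q.2.1 t) (q.2.2 k) := by
  ext j
  change Ev t k ((pIP q).symm j) = _
  simp only [Ev, Pi.single_apply]
  congr 1
  rw [Equiv.symm_apply_eq]
  rfl

lemma rho_kappa (q : QG) (i : Fin 4) : rho q (kappa i, 0) = (kappa (q.1 i), 0) := by
  rw [rho_apply]; simp [aK_kappa]

lemma rho_Ev (q : QG) (t : F3) (k : Fin 2) :
    rho q (0, Ev t k) = (0, Ev (q.2.1 t) (q.2.2 k)) := by
  rw [rho_apply]; simp [aP_Ev]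

lemma single_inj {ι : Type} [DecidableEq ι] {i j : ι}
    (h : (Pi.single i 1 : ι → ℚ) = Pi.single j 1) : i = j := by
  have := congrFun h i
  by_contra hne
  simp [Pi.single_apply, hne] at this

lemma rho_inj : Function.Injective rho := by
  intro q r h
  have h1 : ∀ i, q.1 i = r.1 i := fun i => by
    have := congrArg (fun f => f (kappa i, (0 : VP))) h
    simp only [rho_kappa, Prod.mk.injEq] at this
    exact single_inj this.1
  have h2 : ∀ t k, (q.2.1 t, q.2.2 k) = (r.2.1 t, r.2.2 k) := fun t k => by
    have := congrArg (fun f => f ((0 : VK), Ev t k)) h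
    simp only [rho_Ev, Prod.mk.injEq] at this
    exact single_inj this.2
  refine Prod.ext (Equiv.ext h1) (Prod.ext (Equiv.ext fun t => ?_) (Equiv.ext fun k => ?_))
  · exact (Prod.ext_iff.1 (h2 t 0)).1
  · exact (Prod.ext_iff.1 (h2 0 k)).2

lemma BP_inv (q : QG) (x y : VP) : BP (aP q x) (aP q y) = BP x y := by
  unfold BP
  rw [← Equiv.sum_comp (pIP q)]
  refine Finset.sum_congr rfl fun i _ => ?_
  rw [← Equiv.sum_comp (pIP q)]
  refine Finset.sum_congr rfl fun j _ => ?_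
  have e : ∀ (z : VP) i, aP q z (pIP q i) = z i := fun z i =>
    congrArg z ((pIP q).symm_apply_apply i)
  rw [e, e]
  have : GP (pIP q i) (pIP q j) = GP i j := by
    simp [GP, pIP]
  rw [this]

def GKinv (q : QG) : Prop := ∀ i j, GK (q.1 i) (q.1 j) = GK i j

lemma BK_inv (q : QG) (hq : GKinv q) (x y : VK) : BK (aK q x) (aK q y) = BK x y := by
  unfold BK
  rw [← Equiv.sum_comp q.1]
  refine Finset.sum_congr rfl fun i _ => ?_
  rw [← Equiv.sum_comp q.1]
  refine Finset.sum_congr rfl fun j _ => ?_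
  have e : ∀ (z : VK) i, aK q z (q.1 i) = z i := fun z i =>
    congrArg z (q.1.symm_apply_apply i)
  rw [e, e, hq]

lemma Bf_inv (q : QG) (hq : GKinv q) (v w : VK × VP) : Bf (rho q v) (rho q w) = Bf v w := by
  simp only [Bf, rho_apply, BK_inv q hq, BP_inv]

lemma aK_Klat (q : QG) (x : VK) (hx : x ∈ Klat) : aK q x ∈ Klat := by
  induction hx using Submodule.span_induction with
  | mem x h => obtain ⟨i, rfl⟩ := h; rw [aK_kappa]; exact Submodule.subset_span ⟨_, rfl⟩
  | zero => simp
  | add x y _ _ h1 h2 => rw [map_add]; exact add_mem h1 h2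
  | smul a x _ h => rw [map_zsmul]; exact Submodule.smul_mem _ _ h

lemma pow_pres {α : Type*} (f : QG → α → α) (h1 : ∀ x, f 1 x = x)
    (hm : ∀ q r x, f (q * r) x = f q (f r x)) (S : Set α) (q : QG)
    (hS : ∀ x ∈ S, f q x ∈ S) (n : ℕ) : ∀ x ∈ S, f (q ^ n) x ∈ S := by
  induction n with
  | zero => intro x hx; rw [pow_zero, h1]; exact hx
  | succ n ih => intro x hx; rw [pow_succ, hm]; exact ih _ (hS x hx)

lemma inv_eq_pow (q : QG) (h : q ^ 12 = 1) : q⁻¹ = q ^ 11 := by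
  rw [inv_eq_iff_mul_eq_one, ← pow_succ', h]

lemma dualK_pres (q : QG) (hq : GKinv q) (x : VK) (hx : x ∈ dualK Klat) :
    aK q x ∈ dualK Klat := by
  intro y hy
  obtain ⟨n, hn⟩ := hx (aK q⁻¹ y) (aK_Klat _ _ hy)
  refine ⟨n, ?_⟩
  rw [← hn, ← BK_inv q hq x, ← aK_mul, mul_inv_cancel, aK_one]

lemma dualP_pres (q : QG) (h12 : q ^ 12 = 1) (hP : ∀ x ∈ Plat, aP q x ∈ Plat) (x : VP)
    (hx : x ∈ dualP Plat) : aP q x ∈ dualP Plat := by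
  intro y hy
  obtain ⟨n, hn⟩ := hx (aP q⁻¹ y) (by
    rw [inv_eq_pow q h12]
    exact pow_pres (fun q x => aP q x) aP_one aP_mul Plat q hP 11 y hy)
  refine ⟨n, ?_⟩
  rw [← hn, ← BP_inv q x, ← aP_mul, mul_inv_cancel, aP_one]

lemma intvec_mem (x : VK) (n : Fin 4 → ℤ) (h : ∀ i, x i = n i) : x ∈ Klat := by
  have : x = ∑ i, n i • kappa i := by
    ext j
    rw [h, Finset.sum_apply]
    simp [kappa, Pi.single_apply]
  rw [this]
  exact sum_mem fun i _ => Submodule.smul_mem _ _ (Submodule.subset_span ⟨i, rfl⟩)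

lemma BK_kappa (x : VK) : BK x (kappa 0) = 2 * x 0 + x 1 ∧ BK x (kappa 1) = x 0 + 2 * x 1 ∧
    BK x (kappa 2) = 3 * x 3 ∧ BK x (kappa 3) = 3 * x 2 := by
  refine ⟨?_, ?_, ?_, ?_⟩ <;>
  simp [BK, kappa, GK, Fin.sum_univ_four, Pi.single_apply] <;> ring

lemma dualK_gen (x : VK) (hx : x ∈ dualK Klat) :
    ∃ a : Fin 3 → ℤ, x - ∑ j, a j • kv j ∈ Klat := by
  have hk : ∀ i, kappa i ∈ Klat := fun i => Submodule.subset_span ⟨i, rfl⟩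
  obtain ⟨h0, h1, h2, h3⟩ := BK_kappa x
  obtain ⟨n0, e0⟩ := hx _ (hk 0)
  obtain ⟨n1, e1⟩ := hx _ (hk 1)
  obtain ⟨n2, e2⟩ := hx _ (hk 2)
  obtain ⟨n3, e3⟩ := hx _ (hk 3)
  rw [h0] at e0
  rw [h1] at e1
  rw [h2] at e2
  rw [h3] at e3
  refine ⟨![-((n0 + n1) - (n2 + n3)), n2 - n3, -((n0 + n1) + (n2 + n3))],
    intvec_mem _ ![2 * n0 + n1, -n0, -n2, -n3] ?_⟩
  intro i
  simp only [Finset.sum_apply, Pi.sub_apply, Fin.sum_univ_three, Pi.add_apply, Pi.smul_apply]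
  fin_cases i <;> simp [kv, k1, k2, k3, kappa, Pi.single_apply] <;> linarith

lemma gamma_class (hk : ∀ j : Fin 3, kv j ∈ dualK Klat) (hp : ∀ j : Fin 3, pv j ∈ dualP Plat)
    (γ : DK ≃+ DP)
    (hγ : ∀ j : Fin 3, γ ⟨Klat.mkQ (kv j), Submodule.mem_map_of_mem (hk j)⟩ =
      ⟨Plat.mkQ (pv j), Submodule.mem_map_of_mem (hp j)⟩)
    (x : VK) (hx : x ∈ dualK Klat) (a : Fin 3 → ℤ) (h : x - ∑ j, a j • kv j ∈ Klat) :
    (γ ⟨Klat.mkQ x, Submodule.mem_map_of_mem hx⟩ : VP ⧸ Plat) =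
      Plat.mkQ (∑ j, a j • pv j) := by
  have e : (⟨Klat.mkQ x, Submodule.mem_map_of_mem hx⟩ : DK) =
      ∑ j, a j • (⟨Klat.mkQ (kv j), Submodule.mem_map_of_mem (hk j)⟩ : DK) := by
    apply Subtype.ext
    have h2 : Klat.mkQ x = Klat.mkQ (∑ j, a j • kv j) := by
      exact (Submodule.Quotient.eq Klat).2 h
    simp only [h2, map_sum, map_zsmul, AddSubmonoidClass.coe_finsetSum, Submodule.coe_smul]
  rw [e]
  simp only [map_sum, map_zsmul, hγ, AddSubmonoidClass.coe_finsetSum, Submodule.coe_smul]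

structure Good (q : QG) (c : Fin 3 → ℤ) : Prop where
  gk : GKinv q
  h12 : q ^ 12 = 1
  hP : ∀ x ∈ Plat, aP q x ∈ Plat
  hk : ∀ j, aK q (kv j) = c j • kv j
  hp : ∀ j, aP q (pv j) - c j • pv j ∈ Plat

lemma gamma_inv (hk : ∀ j : Fin 3, kv j ∈ dualK Klat) (hp : ∀ j : Fin 3, pv j ∈ dualP Plat)
    (γ : DK ≃+ DP)
    (hγ : ∀ j : Fin 3, γ ⟨Klat.mkQ (kv j), Submodule.mem_map_of_mem (hk j)⟩ =
      ⟨Plat.mkQ (pv j), Submodule.mem_map_of_mem (hp j)⟩)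
    (Γ : Set (VK × VP))
    (hΓ : Γ = {v | ∃ (hx : v.1 ∈ dualK Klat) (hy : v.2 ∈ dualP Plat),
      γ ⟨Klat.mkQ v.1, Submodule.mem_map_of_mem hx⟩ =
        ⟨Plat.mkQ v.2, Submodule.mem_map_of_mem hy⟩})
    (q : QG) (c : Fin 3 → ℤ) (hq : Good q c) : ((fun v => rho q v) '' Γ = Γ) := by
  have key : ∀ v ∈ Γ, rho q v ∈ Γ := by
    intro v hv
    rw [hΓ] at hv ⊢
    obtain ⟨hx, hy, h⟩ := hv
    obtain ⟨a, ha⟩ := dualK_gen _ hx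
    have h1 := gamma_class hk hp γ hγ _ hx a ha
    rw [h] at h1
    have h1 : v.2 - ∑ j, a j • pv j ∈ Plat := (Submodule.Quotient.eq Plat).1 h1
    refine ⟨dualK_pres q hq.gk _ hx, dualP_pres q hq.h12 hq.hP _ hy, Subtype.ext ?_⟩
    have h2 := aK_Klat q _ ha
    have e2 : aK q (v.1 - ∑ j, a j • kv j) = aK q v.1 - ∑ j, (a j * c j) • kv j := by
      simp only [map_sub, map_sum, map_zsmul, hq.hk, mul_smul]
    rw [e2] at h2
    refine (gamma_class hk hp γ hγ _ (dualK_pres q hq.gk _ hx) _ h2).trans ?_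
    refine ((Submodule.Quotient.eq Plat).2 ?_).symm
    have e3 : (rho q v).2 - ∑ j, (a j * c j) • pv j = aP q (v.2 - ∑ j, a j • pv j) +
        ∑ j, a j • (aP q (pv j) - c j • pv j) := by
      simp only [rho_apply, map_sub, map_sum, map_zsmul, mul_smul, smul_sub,
        Finset.sum_sub_distrib]
      abel
    rw [e3]
    exact add_mem (hq.hP _ h1) (sum_mem fun j _ => Submodule.smul_mem _ _ (hq.hp j))
  apply Set.Subset.antisymm
  · rintro _ ⟨v, hv, rfl⟩
    exact key v hv
  · intro v hv
    refine ⟨rho (q ^ 11) v, pow_pres (fun q x => rho q x) (fun x => by simp)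
      (fun q r x => by simp) Γ q key 11 v hv, ?_⟩
    change (rho q * rho (q ^ 11)) v = v
    rw [← map_mul, ← pow_succ', hq.h12]
    simp

lemma Ev_mem (t : F3) (k : Fin 2) : Ev t k ∈ Plat :=
  Submodule.subset_span (Or.inl ⟨t, k, rfl⟩)

lemma EV_mem (t : F3) : EV t ∈ Plat :=
  add_mem (Ev_mem t 0) (nsmul_mem (Ev_mem t 1) 2)

lemma par_mem (p p' d : F3) (hd : d ≠ 0) : eL (lineF p d) - eL (lineF p' d) ∈ Plat :=
  Submodule.subset_span (Or.inr ⟨_, _, ⟨p, p', d, hd, rfl, rfl⟩, rfl⟩)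

def g1 : QG := (1, T1, 1)
def g2 : QG := (1, T2, 1)
def gb : QG := (Equiv.swap 2 3, JPerm, Equiv.swap 0 1)

lemma eL_image (σ : Equiv.Perm F3) (L : Finset F3) :
    eL (L.image σ) = (3 : ℚ)⁻¹ • ∑ t ∈ L, EV (σ t) := by
  unfold eL
  rw [Finset.sum_image (fun x _ y _ h => σ.injective h)]

lemma aP_eL_trans (σ : Equiv.Perm F3) (L : Finset F3) :
    aP (1, σ, 1) (eL L) = eL (L.image σ) := by
  rw [eL_image]
  simp only [eL, EV, map_sum, map_smul, map_add, map_nsmul, aP_Ev, Equiv.Perm.one_apply]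

lemma aP_eL_b (L : Finset F3) :
    aP gb (eL L) = - eL (L.image JPerm) + ∑ t ∈ L, (Ev (JPerm t) 0 + Ev (JPerm t) 1) := by
  have e : ∀ t, aP gb (EV t) = - EV (JPerm t) + (3 : ℚ) • (Ev (JPerm t) 0 + Ev (JPerm t) 1) := by
    intro t
    simp only [EV, map_add, map_nsmul, aP_Ev]
    simp only [gb, Equiv.swap_apply_left, Equiv.swap_apply_right]
    module
  rw [eL_image, eL, map_smul, map_sum]
  simp only [e, Finset.sum_add_distrib, Finset.sum_neg_distrib, ← Finset.smul_sum]
  module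

lemma aP_b_mem (L : Finset F3) : aP gb (eL L) + eL (L.image JPerm) ∈ Plat := by
  rw [aP_eL_b, neg_add_cancel_comm]
  exact sum_mem fun t _ => add_mem (Ev_mem _ _) (Ev_mem _ _)

lemma image_line_add (v p d : F3) :
    (lineF p d).image (Equiv.addLeft v) = lineF (v + p) d := by
  simp only [lineF, Finset.image_image]
  congr 1
  funext s
  simp [add_assoc]

lemma image_line_J (p d : F3) : (lineF p d).image JPerm = lineF (JPerm p) (JPerm d) := by
  simp only [lineF, Finset.image_image]
  congr 1
  funext s
  simp [JPerm]
  abel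

lemma J_ne (d : F3) (h : d ≠ 0) : JPerm d ≠ 0 := by
  revert d; decide

lemma P_pres (q : QG)
    (h : ∀ p p' d, d ≠ 0 → aP q (eL (lineF p d) - eL (lineF p' d)) ∈ Plat) :
    ∀ x ∈ Plat, aP q x ∈ Plat := by
  intro x hx
  unfold Plat at hx
  induction hx using Submodule.span_induction with
  | mem x h' =>
    rcases h' with ⟨t, k, rfl⟩ | ⟨_, _, ⟨p, p', d, hd, rfl, rfl⟩, rfl⟩
    · rw [aP_Ev]; exact Ev_mem _ _
    · exact h p p' d hd
  | zero => simp
  | add x y _ _ h1 h2 => rw [map_add]; exact add_mem h1 h2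
  | smul a x _ h => rw [map_zsmul]; exact Submodule.smul_mem _ _ h

lemma good_trans (v : F3) (h12 : ((1, Equiv.addLeft v, 1) : QG) ^ 12 = 1) :
    Good (1, Equiv.addLeft v, 1) 1 where
  gk := fun i j => rfl
  h12 := h12
  hP := P_pres _ fun p p' d hd => by
    rw [map_sub, aP_eL_trans, aP_eL_trans, image_line_add, image_line_add]
    exact par_mem _ _ _ hd
  hk := fun j => by rw [Pi.one_apply, one_smul]; rfl
  hp := by
    have H : ∀ p d p' d' : F3, d ≠ 0 → d' ≠ 0 →
        aP (1, Equiv.addLeft v, 1) (eL (lineF p d) + eL (lineF p' d')) -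
          (1 : ℤ) • (eL (lineF p d) + eL (lineF p' d')) ∈ Plat := by
      intro p d p' d' hd hd'
      rw [map_add, aP_eL_trans, aP_eL_trans, image_line_add, image_line_add, one_smul,
        add_sub_add_comm]
      exact add_mem (par_mem _ _ _ hd) (par_mem _ _ _ hd')
    intro j
    fin_cases j
    · exact H _ _ _ _ (by decide) (by decide)
    · exact H _ _ _ _ (by decide) (by decide)
    · exact H _ _ _ _ (by decide) (by decide)

def L0m : Finset F3 := lineF (0, 0) (-1, 1)

lemma J_L12 : L12.image JPerm = L34 := by decide
lemma J_L34 : L34.image JPerm = L12 := by decide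
lemma J_L00 : L00.image JPerm = L0m := by decide

lemma four_mem : eL L12 + eL L34 + eL L00 + eL L0m ∈ Plat := by
  have e : eL L12 + eL L34 + eL L00 + eL L0m =
      EV (0, 0) + (EV (0, 0) + EV (0, 1) + EV (0, 2)) +
      (eL (lineF (1, 0) (0, 1)) - eL (lineF (0, 0) (0, 1))) +
      (eL (lineF (2, 0) (0, 1)) - eL (lineF (0, 0) (0, 1))) := by
    have h1 : L12 = {(0, 0), (0, 1), (0, 2)} := by decide
    have h2 : L34 = {(0, 0), (1, 0), (2, 0)} := by decide
    have h3 : L00 = {(0, 0), (1, 1), (2, 2)} := by decide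
    have h4 : L0m = {(0, 0), (2, 1), (1, 2)} := by decide
    have h5 : lineF (1, 0) (0, 1) = {(1, 0), (1, 1), (1, 2)} := by decide
    have h6 : lineF (2, 0) (0, 1) = {(2, 0), (2, 1), (2, 2)} := by decide
    have h7 : lineF (0, 0) (0, 1) = {(0, 0), (0, 1), (0, 2)} := by decide
    have S : ∀ a b c : F3, a ≠ b → a ≠ c → b ≠ c →
        eL {a, b, c} = (3 : ℚ)⁻¹ • (EV a + EV b + EV c) := by
      intro a b c hab hac hbc
      rw [eL, Finset.sum_insert (by simp [hab, hac]), Finset.sum_pair hbc, add_assoc]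
    rw [h1, h2, h3, h4, h5, h6, h7]
    rw [S (0, 0) (0, 1) (0, 2) (by decide) (by decide) (by decide),
      S (0, 0) (1, 0) (2, 0) (by decide) (by decide) (by decide),
      S (0, 0) (1, 1) (2, 2) (by decide) (by decide) (by decide),
      S (0, 0) (2, 1) (1, 2) (by decide) (by decide) (by decide),
      S (1, 0) (1, 1) (1, 2) (by decide) (by decide) (by decide),
      S (2, 0) (2, 1) (2, 2) (by decide) (by decide) (by decide)]
    module
  rw [e]
  refine add_mem (add_mem (add_mem (EV_mem _) (add_mem (add_mem (EV_mem _) (EV_mem _))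
    (EV_mem _))) (par_mem _ _ _ (by decide))) (par_mem _ _ _ (by decide))

lemma good_b : Good gb ![1, -1, 1] where
  gk := by
    intro i j
    fin_cases i <;> fin_cases j <;> rfl
  h12 := by
    refine Prod.ext ?_ (Prod.ext ?_ ?_) <;> decide
  hP := P_pres _ fun p p' d hd => by
    rw [map_sub]
    have h1 := aP_b_mem (lineF p d)
    have h2 := aP_b_mem (lineF p' d)
    rw [image_line_J] at h1 h2
    have h3 := par_mem (JPerm p) (JPerm p') (JPerm d) (J_ne d hd)
    have := sub_mem (sub_mem h1 h2) h3
    convert this using 1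
    abel
  hk := by
    intro j
    have e2 : gb.1 2 = 3 := by decide
    have e3 : gb.1 3 = 2 := by decide
    have e0 : gb.1 0 = 0 := by decide
    have e1 : gb.1 1 = 1 := by decide
    fin_cases j <;>
    simp only [kv, k1, k2, k3, Fin.mk_one, Fin.reduceFinMk, Fin.zero_eta, Matrix.cons_val, map_smul, map_add, map_sub, map_nsmul, aK_kappa, e0, e1, e2, e3] <;>
    module
  hp := by
    have a := aP_b_mem L12
    have b := aP_b_mem L34
    have c := aP_b_mem L00
    rw [J_L12] at a
    rw [J_L34] at b
    rw [J_L00] at c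
    have f := four_mem
    intro j
    fin_cases j
    · convert sub_mem (add_mem b c) f using 1
      simp [pv, p1]
      abel
    · convert add_mem a b using 1
      simp [pv, p2]
      abel
    · convert sub_mem (add_mem a c) f using 1
      simp [pv, p3]
      abel

def HQ : Subgroup QG := Subgroup.closure {g1, g2, gb}

def fQ (x : Fin 3 × Fin 3 × Fin 4) : QG := g1 ^ x.1.val * g2 ^ x.2.1.val * gb ^ x.2.2.val


lemma gen_left : ∀ x, g1 * fQ x = fQ (x.1 + 1, x.2) ∧ g2 * fQ x = fQ (x.1, x.2.1 + 1, x.2.2) ∧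
    gb * fQ x = fQ (-x.2.1, x.1, x.2.2 + 1) := by
  have h1 : ∀ (a b : Fin 3) (c : Fin 4), g1 * fQ (a, b, c) = fQ (a + 1, b, c) := by
    decide +kernel
  have h2 : ∀ (a b : Fin 3) (c : Fin 4), g2 * fQ (a, b, c) = fQ (a, b + 1, c) := by
    decide +kernel
  have h3 : ∀ (a b : Fin 3) (c : Fin 4), gb * fQ (a, b, c) = fQ (-b, a, c + 1) := by
    decide +kernel
  exact fun ⟨a, b, c⟩ => ⟨h1 a b c, h2 a b c, h3 a b c⟩

lemma mem_HQ (g : QG) : g ∈ HQ ↔ ∃ z, fQ z = g := by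
  constructor
  · intro h
    have hp : ∀ s : QG, s ^ 12 = 1 → (∀ y ∈ Set.range fQ, s * y ∈ Set.range fQ) →
        (∀ y ∈ Set.range fQ, s⁻¹ * y ∈ Set.range fQ) := by
      intro s hs h y hy
      rw [inv_eq_pow s hs]
      exact pow_pres (fun q x => q * x) one_mul mul_assoc (Set.range fQ) s h 11 y hy
    have H : ∀ s ∈ ({g1, g2, gb} : Set QG), s ^ 12 = 1 ∧
        ∀ y ∈ Set.range fQ, s * y ∈ Set.range fQ := by
      rintro s (rfl | rfl | rfl)
      · exact ⟨by decide +kernel, by rintro _ ⟨x, rfl⟩; exact ⟨_, (gen_left x).1.symm⟩⟩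
      · exact ⟨by decide +kernel, by rintro _ ⟨x, rfl⟩; exact ⟨_, (gen_left x).2.1.symm⟩⟩
      · exact ⟨by decide +kernel, by rintro _ ⟨x, rfl⟩; exact ⟨_, (gen_left x).2.2.symm⟩⟩
    change g ∈ Set.range fQ
    unfold HQ at h
    induction h using Subgroup.closure_induction_left with
    | one => exact ⟨0, rfl⟩
    | mul_left s hs y _ ih => exact (H s hs).2 y ih
    | inv_mul_cancel s hs y _ ih => exact hp s (H s hs).1 (H s hs).2 y ih
  · rintro ⟨z, rfl⟩
    have h : ∀ s ∈ ({g1, g2, gb} : Set QG), s ∈ HQ := fun s hs => Subgroup.subset_closure hs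
    exact mul_mem (mul_mem (pow_mem (h _ (by simp)) _) (pow_mem (h _ (by simp)) _))
      (pow_mem (h _ (by simp)) _)

def cF (a b : Fin 3) : F3 := @Prod.mk (ZMod 3) (ZMod 3) a b

def dirs : Fin 4 → F3 := ![((1, 0) : F3), (0, 1), (-1, 0), (0, -1)]

lemma fQ_inj : ∀ x y, (fQ x).2.1 = (fQ y).2.1 → x = y := by
  have A : ∀ (a b : Fin 3) (c : Fin 4), (fQ (a, b, c)).2.1 (0, 0) = cF a b := by
    decide +kernel
  have B : ∀ (a b : Fin 3) (c : Fin 4), (fQ (a, b, c)).2.1 (1, 0) = cF a b + dirs c := by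
    decide +kernel
  have H2 : ∀ c c', dirs c = dirs c' → c = c' := by decide +kernel
  rintro ⟨a, b, c⟩ ⟨a', b', c'⟩ h
  have hA := A a b c
  have hB := B a b c
  rw [h, A] at hA
  rw [h, B, hA] at hB
  have h3 := H2 _ _ (add_left_cancel hB)
  have h4 := Prod.ext_iff.1 hA
  exact Prod.ext h4.1.symm (Prod.ext h4.2.symm h3.symm)

lemma card_HQ : Nat.card HQ = 36 := by
  have e : (Fin 3 × Fin 3 × Fin 4) ≃ HQ := Equiv.ofBijective
    (fun x => ⟨fQ x, (mem_HQ _).2 ⟨x, rfl⟩⟩) ⟨fun x y h => fQ_inj x y (by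
      rw [Subtype.mk.injEq] at h; rw [h]), fun ⟨g, hg⟩ => by
      obtain ⟨x, rfl⟩ := (mem_HQ g).1 hg
      exact ⟨x, rfl⟩⟩
  rw [← Nat.card_congr e]
  simp

def isoOf {G : Type*} [Group G] (φ : QG →* G) (h : Function.Injective (φ.comp HQ.subtype))
    (K : Subgroup G) (hK : K = Subgroup.closure {φ g1, φ g2, φ gb}) : HQ ≃* K :=
  (MonoidHom.ofInjective h).trans (MulEquiv.subgroupCongr (by
    rw [MonoidHom.range_comp, Subgroup.range_subtype, HQ, MonoidHom.map_closure, hK]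
    simp [Set.image_insert_eq]))

def iso1 : HQ ≃* (Subgroup.closure {rho g1, rho g2, rho gb} :
    Subgroup ((VK × VP) ≃ₗ[ℚ] (VK × VP))) :=
  isoOf rho (rho_inj.comp Subtype.val_injective) _ rfl

def iso2 : HQ ≃* ModelGroup :=
  isoOf ((MonoidHom.fst _ _).comp (MonoidHom.snd _ _)) (by
    rintro ⟨x, hx⟩ ⟨y, hy⟩ h
    obtain ⟨a, rfl⟩ := (mem_HQ x).1 hx
    obtain ⟨b, rfl⟩ := (mem_HQ y).1 hy
    have := fQ_inj a b h
    subst this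
    rfl) _ rfl

theorem statement7
    (hk : ∀ j : Fin 3, kv j ∈ dualK Klat) (hp : ∀ j : Fin 3, pv j ∈ dualP Plat)
    -- γ is the gluing isomorphism with γ(k_j + K) = p_j + P
    (γ : DK ≃+ DP)
    (hγ : ∀ j : Fin 3, γ ⟨Klat.mkQ (kv j), Submodule.mem_map_of_mem (hk j)⟩ =
      ⟨Plat.mkQ (pv j), Submodule.mem_map_of_mem (hp j)⟩)
    -- Γ is the glued lattice
    (Γ : Set (VK × VP))
    (hΓ : Γ = {v | ∃ (hx : v.1 ∈ dualK Klat) (hy : v.2 ∈ dualP Plat),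
      γ ⟨Klat.mkQ v.1, Submodule.mem_map_of_mem hx⟩ =
        ⟨Plat.mkQ v.2, Submodule.mem_map_of_mem hy⟩}) :
    ∃ A1 A2 Bt : (VK × VP) ≃ₗ[ℚ] (VK × VP),
      -- defining values of α¹
      (∀ i : Fin 4, A1 (kappa i, 0) = (kappa i, 0)) ∧
      (∀ (t : F3) (k : Fin 2), A1 (0, Ev t k) = (0, Ev (t + (1, 0)) k)) ∧
      -- defining values of α²
      (∀ i : Fin 4, A2 (kappa i, 0) = (kappa i, 0)) ∧
      (∀ (t : F3) (k : Fin 2), A2 (0, Ev t k) = (0, Ev (t + (0, 1)) k)) ∧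
      -- defining values of β
      (Bt (kappa 0, 0) = (kappa 0, 0)) ∧ (Bt (kappa 1, 0) = (kappa 1, 0)) ∧
      (Bt (kappa 2, 0) = (kappa 3, 0)) ∧ (Bt (kappa 3, 0) = (kappa 2, 0)) ∧
      (∀ (t : F3) (k : Fin 2), Bt (0, Ev t k) = (0, Ev (-t.2, t.1) k.rev)) ∧
      -- the three maps preserve the bilinear form
      (∀ v w, Bf (A1 v) (A1 w) = Bf v w) ∧
      (∀ v w, Bf (A2 v) (A2 w) = Bf v w) ∧
      (∀ v w, Bf (Bt v) (Bt w) = Bf v w) ∧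
      -- they map the glued lattice Γ onto itself
      ((fun v => A1 v) '' Γ = Γ) ∧ ((fun v => A2 v) '' Γ = Γ) ∧ ((fun v => Bt v) '' Γ = Γ) ∧
      -- the subgroup they generate has order 36 and is isomorphic to (ℤ/3 × ℤ/3) ⋊ ℤ/4
      Nat.card (Subgroup.closure {A1, A2, Bt} : Subgroup ((VK × VP) ≃ₗ[ℚ] (VK × VP))) = 36 ∧
      Nonempty ((Subgroup.closure {A1, A2, Bt} : Subgroup ((VK × VP) ≃ₗ[ℚ] (VK × VP))) ≃*
        ModelGroup) := by
  have G1 : Good g1 1 := good_trans (1, 0) (by decide +kernel)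
  have G2 : Good g2 1 := good_trans (0, 1) (by decide +kernel)
  have Gb := good_b
  refine ⟨rho g1, rho g2, rho gb, fun i => rho_kappa _ i, fun t k => ?_,
    fun i => rho_kappa _ i, fun t k => ?_, rho_kappa _ _, rho_kappa _ _, ?_, ?_, fun t k => ?_,
    Bf_inv _ G1.gk, Bf_inv _ G2.gk, Bf_inv _ Gb.gk,
    gamma_inv hk hp γ hγ Γ hΓ _ _ G1, gamma_inv hk hp γ hγ Γ hΓ _ _ G2,
    gamma_inv hk hp γ hγ Γ hΓ _ _ Gb, ?_, ⟨iso1.symm.trans iso2⟩⟩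
  · rw [rho_Ev, add_comm]; rfl
  · rw [rho_Ev, add_comm]; rfl
  · rw [rho_kappa]; rfl
  · rw [rho_kappa]; rfl
  · rw [rho_Ev]
    fin_cases k <;> rfl
  · rw [← Nat.card_congr iso1.toEquiv, card_HQ]
end
end

section
/- Suppose j, j' : P⊗ℚ → W are ℚ-linear maps such that ⟨j(x), j(y)⟩ = −⟨x,y⟩ and ⟨j'(x), j'(y)⟩ = −⟨x,y⟩ for all x, y ∈ P⊗ℚ, with j(P) ⊆ N, j'(P) ⊆ N, and both j(P) and j'(P) primitive sublattices of N. Then there exists a linear isometry Φ of W with Φ(N) = N and Φ(j(x)) = j'(x) for all x ∈ P. In other words, the primitive embedding of P with negated form into the Niemeier lattice N of type A₂¹² is unique up to automorphisms of N. -/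
noncomputable section

abbrev JN : Type := Fin 12 × Fin 2
abbrev WN : Type := JN → ℚ

/-- The simple roots `Ẽ_j^(k)` (with `k : Fin 2` corresponding to `k+1 ∈ {1,2}`). -/
def Et (j : Fin 12) (k : Fin 2) : WN := Pi.single (j, k) 1

/-- Gram coefficients of the (positive definite) bilinear form on `W`. -/
def GN : JN → JN → ℚ := fun i j =>
  if i.1 = j.1 then (if i.2 = j.2 then 2 else -1) else 0

/-- The symmetric bilinear form on `W`. -/
def BW (x y : WN) : ℚ := ∑ i : JN, ∑ j : JN, x i * GN i j * y j

/-- `Ẽ_j := Ẽ_j^(1) + 2·Ẽ_j^(2)`. -/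
def EtV (j : Fin 12) : WN := Et j 0 + 2 • Et j 1

/-- The rows of the generating matrix of the glue code. -/
def glueMat : Fin 6 → Fin 12 → ℚ :=
  ![![0, 1, 1, 1, 1, 1, 1, 0, 0, 0, 0, 0],
    ![-1, 0, 1, -1, -1, 1, 0, 1, 0, 0, 0, 0],
    ![-1, 1, 0, 1, -1, -1, 0, 0, 1, 0, 0, 0],
    ![-1, -1, 1, 0, 1, -1, 0, 0, 0, 1, 0, 0],
    ![-1, -1, -1, 1, 0, 1, 0, 0, 0, 0, 1, 0],
    ![-1, 1, -1, -1, 1, 0, 0, 0, 0, 0, 0, 1]]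

/-- The glue vectors `w_i := (1/3)·∑_j a_{ij}·Ẽ_j`. -/
def wvec (i : Fin 6) : WN := (3 : ℚ)⁻¹ • ∑ j : Fin 12, glueMat i j • EtV j

/-- The Niemeier lattice `N` of type `A₂¹²`. -/
def NL : Submodule ℤ WN :=
  Submodule.span ℤ ({x | ∃ j k, x = Et j k} ∪ Set.range wvec)


set_option linter.unusedSimpArgs false

def gI : Fin 6 → Fin 12 → ℤ :=
  ![![0, 1, 1, 1, 1, 1, 1, 0, 0, 0, 0, 0],
    ![-1, 0, 1, -1, -1, 1, 0, 1, 0, 0, 0, 0],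
    ![-1, 1, 0, 1, -1, -1, 0, 0, 1, 0, 0, 0],
    ![-1, -1, 1, 0, 1, -1, 0, 0, 0, 1, 0, 0],
    ![-1, -1, -1, 1, 0, 1, 0, 0, 0, 0, 1, 0],
    ![-1, 1, -1, -1, 1, 0, 0, 0, 0, 0, 0, 1]]

lemma glue_eq (i : Fin 6) (j : Fin 12) : glueMat i j = (gI i j : ℚ) := by
  fin_cases i <;> fin_cases j <;> simp [glueMat, gI]

lemma gI_orth (i l : Fin 6) : (3 : ℤ) ∣ ∑ j, gI i j * gI l j := by
  revert i l; decide +kernel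

/-- Code condition. -/
def Code (m : Fin 12 → ℤ) : Prop := ∀ i, (3 : ℤ) ∣ ∑ j, gI i j * m j

def wtc (x : ZMod 3) : ℕ := if x = 0 then 0 else 1

lemma code_dec : ∀ a b c d e f : ZMod 3,
    wtc a + wtc b + wtc c + wtc d + wtc e + wtc f
    + wtc (b + c + d + e + f) + wtc (-a + c - d - e + f) + wtc (-a + b + d - e - f)
    + wtc (-a - b + c + e - f) + wtc (-a - b - c + d + f) + wtc (-a + b - c - d + e) ≤ 3 →
    a = 0 ∧ b = 0 ∧ c = 0 ∧ d = 0 ∧ e = 0 ∧ f = 0 := by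
  decide +kernel

lemma wtc_neg : ∀ x : ZMod 3, wtc (-x) = wtc x := by decide

lemma code_min (m : Fin 12 → ℤ) (hm : Code m) (hw : ∑ j, wtc (m j : ZMod 3) ≤ 3) :
    ∀ j, (3 : ℤ) ∣ m j := by
  have h : ∀ i, ∑ j, (gI i j : ZMod 3) * (m j : ZMod 3) = 0 := by
    intro i
    have := (ZMod.intCast_zmod_eq_zero_iff_dvd (∑ j, gI i j * m j) 3).2 (by exact_mod_cast hm i)
    push_cast at this
    exact this
  have h0 := h 0
  have h1 := h 1
  have h2 := h 2
  have h3 := h 3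
  have h4 := h 4
  have h5 := h 5
  simp [Fin.sum_univ_succ, gI] at h0 h1 h2 h3 h4 h5
  simp [Fin.sum_univ_succ] at hw
  have key : ∀ j, (m j : ZMod 3) = 0 := by
    have e0 : (m 6 : ZMod 3) = -(m 1 + m 2 + m 3 + m 4 + m 5) := by linear_combination h0
    have e1 : (m 7 : ZMod 3) = -(-m 0 + m 2 - m 3 - m 4 + m 5) := by linear_combination h1
    have e2 : (m 8 : ZMod 3) = -(-m 0 + m 1 + m 3 - m 4 - m 5) := by linear_combination h2
    have e3 : (m 9 : ZMod 3) = -(-m 0 - m 1 + m 2 + m 4 - m 5) := by linear_combination h3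
    have e4 : (m 10 : ZMod 3) = -(-m 0 - m 1 - m 2 + m 3 + m 5) := by linear_combination h4
    have e5 : (m 11 : ZMod 3) = -(-m 0 + m 1 - m 2 - m 3 + m 4) := by linear_combination h5
    rw [e0, e1, e2, e3, e4, e5] at hw
    simp only [wtc_neg] at hw
    obtain ⟨a0, a1, a2, a3, a4, a5⟩ := code_dec (m 0) (m 1) (m 2) (m 3) (m 4) (m 5) (by omega)
    simp only [a0, a1, a2, a3, a4, a5, add_zero, sub_zero, neg_zero] at e0 e1 e2 e3 e4 e5
    intro j
    fin_cases j <;> assumption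
  intro j
  exact_mod_cast (ZMod.intCast_zmod_eq_zero_iff_dvd (m j) 3).1 (key j)

def gN : Fin 12 → ℕ × ℕ × ℕ × ℕ × ℕ × ℕ :=
  ![(0,2,2,2,2,2),(1,0,1,2,2,1),(1,1,0,1,2,2),(1,2,1,0,1,2),(1,2,2,1,0,1),(1,1,2,2,1,0),
   (1,0,0,0,0,0),(0,1,0,0,0,0),(0,0,1,0,0,0),(0,0,0,1,0,0),(0,0,0,0,1,0),(0,0,0,0,0,1)]

def dotN (u v : ℕ × ℕ × ℕ × ℕ × ℕ × ℕ) : ℕ :=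
  (u.1 * v.1 + u.2.1 * v.2.1 + u.2.2.1 * v.2.2.1 + u.2.2.2.1 * v.2.2.2.1
    + u.2.2.2.2.1 * v.2.2.2.2.1 + u.2.2.2.2.2 * v.2.2.2.2.2) % 3

def srch (a b c : Fin 12) : Bool :=
  [0,1,2].any fun x0 => [0,1,2].any fun x1 => [0,1,2].any fun x2 => [0,1,2].any fun x3 =>
  [0,1,2].any fun x4 => [0,1,2].any fun x5 =>
    Nat.beq (dotN (gN a) (x0,x1,x2,x3,x4,x5)) 1 &&
    Nat.beq (dotN (gN b) (x0,x1,x2,x3,x4,x5)) 0 &&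
    Nat.beq (dotN (gN c) (x0,x1,x2,x3,x4,x5)) 0

lemma srch_all : ∀ a b c : Fin 12, a ≠ b → a ≠ c → srch a b c = true := by
  decide +kernel

def toT (x : Fin 6 → ℕ) : ℕ × ℕ × ℕ × ℕ × ℕ × ℕ := (x 0, x 1, x 2, x 3, x 4, x 5)

lemma dot_gI (a : Fin 12) (x : Fin 6 → ℕ) :
    (3 : ℤ) ∣ (∑ i, (x i : ℤ) * gI i a) - (dotN (gN a) (toT x) : ℤ) := by
  fin_cases a <;> simp [Fin.sum_univ_succ, gI, gN, dotN, toT] <;> omega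

lemma srch_ex (a b c : Fin 12) (h : srch a b c = true) : ∃ x : Fin 6 → ℕ,
    dotN (gN a) (toT x) = 1 ∧ dotN (gN b) (toT x) = 0 ∧ dotN (gN c) (toT x) = 0 := by
  unfold srch at h
  simp only [List.any_eq_true, Bool.and_eq_true, Nat.beq_eq] at h
  obtain ⟨x0, -, x1, -, x2, -, x3, -, x4, -, x5, -, ⟨h1, h2⟩, h3⟩ := h
  exact ⟨![x0, x1, x2, x3, x4, x5], h1, h2, h3⟩

lemma code_sum (x : Fin 6 → ℤ) : Code (fun j => ∑ i, x i * gI i j) := by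
  intro l
  have : ∑ j, gI l j * ∑ i, x i * gI i j = ∑ i, x i * ∑ j, gI l j * gI i j := by
    simp only [Finset.mul_sum]
    rw [Finset.sum_comm]
    refine Finset.sum_congr rfl fun i _ => Finset.sum_congr rfl fun j _ => by ring
  simp only [this]
  exact Finset.dvd_sum fun i _ => Dvd.dvd.mul_left (gI_orth l i) _

lemma code_congr (m m' : Fin 12 → ℤ) (h : ∀ j, (3 : ℤ) ∣ m j - m' j) (hm : Code m) : Code m' := by
  intro i
  have h1 : (3 : ℤ) ∣ ∑ j, gI i j * (m j - m' j) :=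
    Finset.dvd_sum fun j _ => Dvd.dvd.mul_left (h j) _
  have h2 := hm i
  simp only [mul_sub, Finset.sum_sub_distrib] at h1
  have := dvd_sub h2 h1
  simpa using this

lemma code_glue (a b c : Fin 12) (hab : a ≠ b) (hac : a ≠ c) :
    ∃ m : Fin 12 → ℤ, Code m ∧ m a = 1 ∧ m b = 0 ∧ m c = 0 := by
  obtain ⟨x, h1, h2, h3⟩ := srch_ex a b c (srch_all a b c hab hac)
  refine ⟨fun j => if j = a then 1 else if j = b then 0 else if j = c then 0 else
    ∑ i, (x i : ℤ) * gI i j, ?_, by simp, ?_, ?_⟩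
  · refine code_congr _ _ ?_ (code_sum fun i => (x i : ℤ))
    intro j
    have h := dot_gI j x
    split_ifs with e1 e2 e3
    · subst e1; rw [h1] at h; exact_mod_cast h
    · subst e2; rw [h2] at h; exact_mod_cast h
    · subst e3; rw [h3] at h; exact_mod_cast h
    · simp
  · simp [hab.symm]
  · simp [hac.symm]

lemma BW_eq (x y : WN) : BW x y = ∑ j, (2 * x (j,0) * y (j,0) - x (j,0) * y (j,1)
    - x (j,1) * y (j,0) + 2 * x (j,1) * y (j,1)) := by
  unfold BW
  rw [Fintype.sum_prod_type]
  refine Finset.sum_congr rfl fun j _ => ?_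
  simp only [Fin.sum_univ_two, Fintype.sum_prod_type, GN]
  rw [Finset.sum_eq_single j, Finset.sum_eq_single j]
  · simp; ring
  · intro b _ hb; simp [hb.symm]
  · simp
  · intro b _ hb; simp [hb.symm]
  · simp

lemma BP_eq (x y : VP) : BP x y = -∑ j, (2 * x (j,0) * y (j,0) - x (j,0) * y (j,1)
    - x (j,1) * y (j,0) + 2 * x (j,1) * y (j,1)) := by
  unfold BP
  rw [Fintype.sum_prod_type, ← Finset.sum_neg_distrib]
  refine Finset.sum_congr rfl fun j _ => ?_
  simp only [Fin.sum_univ_two]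
  rw [Fintype.sum_prod_type (fun p : F3 × Fin 2 => x (j, 0) * GP (j, 0) p * y p),
    Fintype.sum_prod_type (fun p : F3 × Fin 2 => x (j, 1) * GP (j, 1) p * y p),
    Finset.sum_eq_single j, Finset.sum_eq_single j]
  · simp [Fin.sum_univ_two, GP]; ring
  · intro b _ hb; simp [hb.symm, GP]
  · simp
  · intro b _ hb; simp [hb.symm, GP]
  · simp

/-- bilinear version -/
def BL : WN →ₗ[ℚ] WN →ₗ[ℚ] ℚ := LinearMap.mk₂ ℚ BW
  (by intro a b c; simp only [BW_eq, ← Finset.sum_add_distrib]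
      exact Finset.sum_congr rfl fun j _ => by simp only [Pi.add_apply]; ring)
  (by intro a b c; simp only [BW_eq, smul_eq_mul, Finset.mul_sum]
      exact Finset.sum_congr rfl fun j _ => by simp only [Pi.smul_apply, smul_eq_mul]; ring)
  (by intro a b c; simp only [BW_eq, ← Finset.sum_add_distrib]
      exact Finset.sum_congr rfl fun j _ => by simp only [Pi.add_apply]; ring)
  (by intro a b c; simp only [BW_eq, smul_eq_mul, Finset.mul_sum]
      exact Finset.sum_congr rfl fun j _ => by simp only [Pi.smul_apply, smul_eq_mul]; ring)

lemma BW_BL (x y : WN) : BW x y = BL x y := rfl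

lemma BL_comm (x y : WN) : BL x y = BL y x := by
  simp only [← BW_BL, BW_eq]
  exact Finset.sum_congr rfl fun j _ => by ring

/-- `(1/3) Ẽ_j` -/
def eps (j : Fin 12) : WN := (3 : ℚ)⁻¹ • EtV j

lemma eps0 (i j : Fin 12) : eps i (j, 0) = if i = j then 1 / 3 else 0 := by
  by_cases h : i = j
  · subst h; simp [eps, EtV, Et]
  · simp [eps, EtV, Et, h, Pi.single_apply, Ne.symm h]
lemma eps1 (i j : Fin 12) : eps i (j, 1) = if i = j then 2 / 3 else 0 := by
  by_cases h : i = j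
  · subst h; simp [eps, EtV, Et, Pi.single_apply]; norm_num
  · simp [eps, EtV, Et, h, Pi.single_apply, Ne.symm h]

lemma BL_Et0 (v : WN) (j : Fin 12) : BL v (Et j 0) = 2 * v (j,0) - v (j,1) := by
  rw [← BW_BL, BW_eq, Finset.sum_eq_single j]
  · simp [Et, Pi.single_apply]
  · intro b _ hb; simp [Et, Pi.single_apply, hb]
  · simp
lemma BL_Et1 (v : WN) (j : Fin 12) : BL v (Et j 1) = 2 * v (j,1) - v (j,0) := by
  rw [← BW_BL, BW_eq, Finset.sum_eq_single j]
  · simp [Et, Pi.single_apply]; ring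
  · intro b _ hb; simp [Et, Pi.single_apply, hb]
  · simp
lemma BL_eps (v : WN) (j : Fin 12) : BL v (eps j) = v (j,1) := by
  simp only [eps, EtV, map_smul, map_add, map_nsmul, BL_Et0, BL_Et1]
  simp only [smul_eq_mul, nsmul_eq_mul]
  push_cast; ring

lemma wvec_eq (i : Fin 6) : wvec i = ∑ j, (gI i j : ℚ) • eps j := by
  simp only [wvec, eps, glue_eq, Finset.smul_sum]
  exact Finset.sum_congr rfl fun j _ => smul_comm _ _ _

lemma Et_mem (j : Fin 12) (k : Fin 2) : Et j k ∈ NL :=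
  Submodule.subset_span (Or.inl ⟨j, k, rfl⟩)
lemma wvec_mem (i : Fin 6) : wvec i ∈ NL :=
  Submodule.subset_span (Or.inr ⟨i, rfl⟩)

/-- Integrality predicate -/
def IsI (q : ℚ) : Prop := ∃ n : ℤ, q = n
lemma IsI.add {p q : ℚ} (hp : IsI p) (hq : IsI q) : IsI (p + q) := by
  obtain ⟨a, rfl⟩ := hp; obtain ⟨b, rfl⟩ := hq; exact ⟨a + b, by push_cast; rfl⟩
lemma IsI.sub {p q : ℚ} (hp : IsI p) (hq : IsI q) : IsI (p - q) := by
  obtain ⟨a, rfl⟩ := hp; obtain ⟨b, rfl⟩ := hq; exact ⟨a - b, by push_cast; rfl⟩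
lemma IsI.neg {p : ℚ} (hp : IsI p) : IsI (-p) := by
  obtain ⟨a, rfl⟩ := hp; exact ⟨-a, by push_cast; rfl⟩
lemma IsI.zmul {p : ℚ} (n : ℤ) (hp : IsI p) : IsI (n * p) := by
  obtain ⟨a, rfl⟩ := hp; exact ⟨n * a, by push_cast; rfl⟩
lemma IsI.zero : IsI 0 := ⟨0, by simp⟩
lemma IsI.int (n : ℤ) : IsI n := ⟨n, rfl⟩
lemma IsI.sum {ι : Type} (s : Finset ι) (u : ι → ℚ) (h : ∀ i ∈ s, IsI (u i)) : IsI (∑ i ∈ s, u i) := by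
  classical
  induction s using Finset.induction_on with
  | empty => simpa using IsI.zero
  | insert a s ha ih =>
    rw [Finset.sum_insert ha]
    exact (h a (by simp)).add (ih fun i hi => h i (by simp [hi]))

lemma isI_span (v : WN) (S : Set WN) (h : ∀ s ∈ S, IsI (BL v s)) :
    ∀ w ∈ Submodule.span ℤ S, IsI (BL v w) := by
  intro w hw
  induction hw using Submodule.span_induction with
  | mem x hx => exact h x hx
  | zero => simpa using IsI.zero
  | add x y _ _ hx hy => rw [map_add]; exact hx.add hy
  | smul a x _ hx => rw [map_zsmul, zsmul_eq_mul]; exact hx.zmul a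

/-- Coordinates description -/
def Coord (v : WN) : Prop := ∃ m n : Fin 12 → ℤ, Code m ∧
  (∀ j, v (j,0) = m j / 3) ∧ (∀ j, v (j,1) = n j - m j / 3)

lemma BL_wvec (v : WN) (i : Fin 6) : BL v (wvec i) = ∑ j, (gI i j : ℚ) * v (j,1) := by
  rw [wvec_eq, map_sum]
  exact Finset.sum_congr rfl fun j _ => by rw [map_smul, BL_eps, smul_eq_mul]

lemma coord_of_dual (v : WN) (h : ∀ w ∈ NL, IsI (BL v w)) : Coord v := by
  have h0 : ∀ j, IsI (BL v (Et j 0)) := fun j => h _ (Et_mem j 0)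
  have h1 : ∀ j, IsI (BL v (Et j 1)) := fun j => h _ (Et_mem j 1)
  choose a ha using h0
  choose b hb using h1
  simp only [BL_Et0] at ha
  simp only [BL_Et1] at hb
  have e0 : ∀ j, v (j,0) = ((2 * a j + b j : ℤ) : ℚ) / 3 := fun j => by
    push_cast; linarith [ha j, hb j]
  have e1 : ∀ j, v (j,1) = ((a j + b j : ℤ) : ℚ) - ((2 * a j + b j : ℤ) : ℚ) / 3 := fun j => by
    push_cast; linarith [ha j, hb j]
  refine ⟨fun j => 2 * a j + b j, fun j => a j + b j, ?_, e0, e1⟩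
  intro i
  obtain ⟨c, hc⟩ := h _ (wvec_mem i)
  rw [BL_wvec] at hc
  simp only [e1, mul_sub, Finset.sum_sub_distrib] at hc
  refine ⟨(∑ j, gI i j * (a j + b j)) - c, ?_⟩
  have : (∑ j, (gI i j : ℚ) * (((2 * a j + b j : ℤ) : ℚ) / 3)) =
    (∑ j, (gI i j : ℚ) * ((2 * a j + b j : ℤ) : ℚ)) / 3 := by
    rw [Finset.sum_div]; exact Finset.sum_congr rfl fun j _ => by ring
  rw [this] at hc
  qify
  push_cast at hc ⊢
  linarith

lemma decomp (v : WN) : v = ∑ j, (v (j,0) • Et j 0 + v (j,1) • Et j 1) := by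
  ext ⟨j, k⟩
  rw [Finset.sum_apply, Finset.sum_eq_single j]
  · fin_cases k <;> simp [Et, Pi.single_apply]
  · intro b _ hb; simp [Et, Pi.single_apply, hb.symm]
  · simp

lemma zq_mem {v : WN} (hv : v ∈ NL) (a : ℤ) : (a : ℚ) • v ∈ NL := by
  rw [Int.cast_smul_eq_zsmul]; exact Submodule.smul_mem _ _ hv

lemma mem_of_int (v : WN) (h : ∀ p, IsI (v p)) : v ∈ NL := by
  choose a ha using h
  rw [decomp v]
  refine Submodule.sum_mem _ fun j _ => Submodule.add_mem _ ?_ ?_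
  · rw [ha]; exact zq_mem (Et_mem _ _) _
  · rw [ha]; exact zq_mem (Et_mem _ _) _

lemma code_red (m : Fin 12 → ℤ) (hm : Code m) (j : Fin 12) :
    (3 : ℤ) ∣ m j - ∑ i : Fin 6, m (Fin.natAdd 6 i) * gI i j := by
  have h0 := hm 0
  have h1 := hm 1
  have h2 := hm 2
  have h3 := hm 3
  have h4 := hm 4
  have h5 := hm 5
  simp [Fin.sum_univ_succ, gI] at h0 h1 h2 h3 h4 h5
  fin_cases j <;> simp [Fin.sum_univ_succ, gI] <;> omega

lemma eps_sum0 (c : Fin 12 → ℚ) (j : Fin 12) : (∑ i, c i • eps i) (j, 0) = c j / 3 := by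
  simp [Finset.sum_apply, eps0]; ring
lemma eps_sum1 (c : Fin 12 → ℚ) (j : Fin 12) : (∑ i, c i • eps i) (j, 1) = 2 * c j / 3 := by
  simp [Finset.sum_apply, eps1]; ring

lemma mem_of_coord (v : WN) (h : Coord v) : v ∈ NL := by
  obtain ⟨m, n, hm, h0, h1⟩ := h
  choose d hd using code_red m hm
  have hs : ∑ i : Fin 6, (m (Fin.natAdd 6 i) : ℚ) • wvec i ∈ NL :=
    Submodule.sum_mem _ fun i _ => zq_mem (wvec_mem i) _
  have e : ∑ i : Fin 6, (m (Fin.natAdd 6 i) : ℚ) • wvec i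
      = ∑ j, ((m j - 3 * d j : ℤ) : ℚ) • eps j := by
    simp only [wvec_eq, Finset.smul_sum, smul_smul]
    rw [Finset.sum_comm]
    refine Finset.sum_congr rfl fun j _ => ?_
    rw [← Finset.sum_smul]
    congr 1
    rw [← hd j]
    push_cast
    ring
  rw [e] at hs
  have : v = (v - ∑ j, ((m j - 3 * d j : ℤ) : ℚ) • eps j)
    + ∑ j, ((m j - 3 * d j : ℤ) : ℚ) • eps j := by abel
  rw [this]
  refine Submodule.add_mem _ (mem_of_int _ ?_) hs
  rintro ⟨j, k⟩
  have : k = 0 ∨ k = 1 := by omega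
  rcases this with rfl | rfl
  · rw [Pi.sub_apply, eps_sum0, h0]
    exact ⟨d j, by push_cast; ring⟩
  · rw [Pi.sub_apply, eps_sum1, h1]
    exact ⟨n j - m j + 2 * d j, by push_cast; ring⟩

lemma NL_int (v w : WN) (hv : v ∈ NL) (hw : w ∈ NL) : IsI (BL v w) := by
  refine isI_span v _ ?_ w hw
  intro s hs
  rw [BL_comm]
  refine isI_span s _ ?_ v hv
  have key : ∀ (j : Fin 12) (k : Fin 2) (i : Fin 6), IsI (BL (wvec i) (Et j k)) := by
    intro j k i
    have : k = 0 ∨ k = 1 := by omega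
    rcases this with rfl | rfl
    · rw [BL_Et0, wvec_eq, eps_sum0, eps_sum1]; exact ⟨0, by push_cast; ring⟩
    · rw [BL_Et1, wvec_eq, eps_sum0, eps_sum1]; exact ⟨gI i j, by ring⟩
  intro r hr
  rcases hs with ⟨j, k, rfl⟩ | ⟨i, rfl⟩ <;> rcases hr with ⟨j', k', rfl⟩ | ⟨i', rfl⟩
  · have : k' = 0 ∨ k' = 1 := by omega
    rcases this with rfl | rfl
    · rw [BL_Et0]
      simp only [Et, Pi.single_apply]
      exact ⟨2 * (if ((j', 0) : JN) = (j, k) then 1 else 0) - (if ((j', 1) : JN) = (j, k) then 1 else 0),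
        by push_cast; rfl⟩
    · rw [BL_Et1]
      simp only [Et, Pi.single_apply]
      exact ⟨2 * (if ((j', 1) : JN) = (j, k) then 1 else 0) - (if ((j', 0) : JN) = (j, k) then 1 else 0),
        by push_cast; rfl⟩
  · rw [BL_comm]; exact key _ _ _
  · exact key _ _ _
  · rw [BL_wvec]
    obtain ⟨c, hc⟩ := gI_orth i' i
    refine ⟨2 * c, ?_⟩
    have : ∑ j, (gI i' j : ℚ) * wvec i (j, 1) = 2 / 3 * ((∑ j, gI i' j * gI i j : ℤ) : ℚ) := by
      push_cast
      rw [Finset.mul_sum]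
      exact Finset.sum_congr rfl fun j _ => by rw [wvec_eq, eps_sum1]; ring
    rw [this, hc]; push_cast; ring

lemma mem_of_dual (v : WN) (h : ∀ w ∈ NL, IsI (BL v w)) : v ∈ NL :=
  mem_of_coord v (coord_of_dual v h)

lemma coord_of_mem (v : WN) (h : v ∈ NL) : Coord v :=
  coord_of_dual v fun w hw => NL_int v w h hw

lemma wt_le (m n : ℤ) : (wtc (m : ZMod 3) : ℤ) ≤ m ^ 2 - 3 * m * n + 3 * n ^ 2 := by
  have h0 : 0 ≤ m ^ 2 - 3 * m * n + 3 * n ^ 2 := by nlinarith [sq_nonneg (2 * m - 3 * n), sq_nonneg n]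
  unfold wtc
  split_ifs with h
  · simpa using h0
  · by_contra hlt
    push Not at hlt
    have hz : m ^ 2 - 3 * m * n + 3 * n ^ 2 = 0 := by push_cast at hlt; omega
    have hn : n = 0 := by
      have : n ^ 2 ≤ 0 := by nlinarith [sq_nonneg (2 * m - 3 * n), sq_nonneg n]
      exact pow_eq_zero_iff (two_ne_zero) |>.1 (le_antisymm this (sq_nonneg n))
    subst hn
    have hm : m = 0 := by simpa using hz
    subst hm
    simp at h

lemma root_supp (v : WN) (hv : v ∈ NL) (h2 : BL v v = 2) : ∃ (j : Fin 12) (a b : ℤ),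
    v (j,0) = a ∧ v (j,1) = b ∧ (∀ i, i ≠ j → ∀ k, v (i,k) = 0) ∧ a ^ 2 - a * b + b ^ 2 = 1 := by
  obtain ⟨m, n, hm, h0, h1⟩ := coord_of_mem v hv
  have hq : ∑ j, (m j ^ 2 - 3 * m j * n j + 3 * n j ^ 2) = 3 := by
    rw [← BW_BL, BW_eq] at h2
    have : (∑ j, ((m j ^ 2 - 3 * m j * n j + 3 * n j ^ 2 : ℤ) : ℚ)) = 3 := by
      have e : (2 / 3 : ℚ) * (∑ j, ((m j ^ 2 - 3 * m j * n j + 3 * n j ^ 2 : ℤ) : ℚ)) = 2 := by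
        refine Eq.trans ?_ h2
        rw [Finset.mul_sum]
        refine Finset.sum_congr rfl fun j _ => ?_
        rw [h0, h1]; push_cast; ring
      linarith
    exact_mod_cast this
  have hd := code_min m hm (by
    have : (∑ j, (wtc (m j : ZMod 3) : ℤ)) ≤ 3 := hq ▸ Finset.sum_le_sum fun j _ => wt_le (m j) (n j)
    exact_mod_cast this)
  choose c hc using hd
  have hr : ∑ j, (3 * c j ^ 2 - 3 * c j * n j + n j ^ 2) = 1 := by
    have : 3 * ∑ j, (3 * c j ^ 2 - 3 * c j * n j + n j ^ 2) = 3 := by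
      refine Eq.trans ?_ hq
      rw [Finset.mul_sum]
      exact Finset.sum_congr rfl fun j _ => by rw [hc]; ring
    omega
  have hnn : ∀ j, 0 ≤ 3 * c j ^ 2 - 3 * c j * n j + n j ^ 2 := fun j => by
    nlinarith [sq_nonneg (2 * n j - 3 * c j), sq_nonneg (c j)]
  obtain ⟨j, -, hj⟩ : ∃ j ∈ Finset.univ, (3 * c j ^ 2 - 3 * c j * n j + n j ^ 2) ≠ 0 := by
    apply Finset.exists_ne_zero_of_sum_ne_zero
    rw [hr]; norm_num
  have hs := Finset.add_sum_erase Finset.univ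
    (fun j => 3 * c j ^ 2 - 3 * c j * n j + n j ^ 2) (Finset.mem_univ j)
  rw [hr] at hs
  have hnn2 : 0 ≤ ∑ i ∈ Finset.univ.erase j, (3 * c i ^ 2 - 3 * c i * n i + n i ^ 2) :=
    Finset.sum_nonneg fun i _ => hnn i
  have hj1 := hnn j
  have hj2 : 3 * c j ^ 2 - 3 * c j * n j + n j ^ 2 = 1 := by
    omega
  have hz : ∑ i ∈ Finset.univ.erase j, (3 * c i ^ 2 - 3 * c i * n i + n i ^ 2) = 0 := by
    omega
  rw [Finset.sum_eq_zero_iff_of_nonneg fun i _ => hnn i] at hz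
  have f0 : ∀ i, v (i,0) = c i := fun i => by rw [h0, hc]; push_cast; ring
  have f1 : ∀ i, v (i,1) = (n i - c i : ℤ) := fun i => by rw [h1, hc]; push_cast; ring
  refine ⟨j, c j, n j - c j, f0 j, f1 j, ?_, by linear_combination hj2⟩
  intro i hi k
  have hzi := hz i (by simp [hi])
  have hci : c i = 0 := by
    have : c i ^ 2 ≤ 0 := by nlinarith [sq_nonneg (2 * n i - 3 * c i), sq_nonneg (c i)]
    exact pow_eq_zero_iff (two_ne_zero) |>.1 (le_antisymm this (sq_nonneg _))
  have hni : n i = 0 := by rw [hci] at hzi; simpa using hzi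
  have : k = 0 ∨ k = 1 := by omega
  rcases this with rfl | rfl
  · rw [f0, hci]; simp
  · rw [f1, hci, hni]; simp

lemma BL_single (v w : WN) (j : Fin 12) (h : ∀ i, i ≠ j → ∀ k, v (i,k) = 0) :
    BL v w = 2 * v (j,0) * w (j,0) - v (j,0) * w (j,1)
    - v (j,1) * w (j,0) + 2 * v (j,1) * w (j,1) := by
  rw [← BW_BL, BW_eq, Finset.sum_eq_single j]
  · intro i _ hi; simp [h i hi]
  · simp

lemma BP_Ev (s t : F3) (k l : Fin 2) : BP (Ev s k) (Ev t l) = GP (s,k) (t,l) := by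
  unfold BP Ev
  rw [Finset.sum_eq_single (s,k), Finset.sum_eq_single (t,l)]
  · simp
  · intro b _ hb; simp [Pi.single_apply, hb]
  · simp
  · intro b _ hb; simp [Pi.single_apply, hb]
  · simp

lemma decompV (v : VP) : v = ∑ p : IP, v p • Ev p.1 p.2 := by
  ext p
  rw [Finset.sum_apply, Finset.sum_eq_single p]
  · simp [Ev]
  · intro b _ hb; simp [Ev, Pi.single_apply, hb.symm]
  · simp

lemma exists_alpha (f : VP →ₗ[ℚ] WN) (hf : ∀ x y : VP, BW (f x) (f y) = -BP x y)
    (hfN : Submodule.map (f.restrictScalars ℤ) Plat ≤ NL) :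
    ∃ α : Fin 3 → Fin 12, Function.Injective α ∧ ∀ x i k, f x (α i, k) = 0 := by
  have hroot : ∀ t k, ∃ (j : Fin 12) (a b : ℤ), f (Ev t k) (j,0) = a ∧ f (Ev t k) (j,1) = b ∧
      (∀ i, i ≠ j → ∀ l, f (Ev t k) (i,l) = 0) ∧ a ^ 2 - a * b + b ^ 2 = 1 := by
    intro t k
    refine root_supp _ (hfN ⟨_, Ev_mem t k, rfl⟩) ?_
    rw [← BW_BL, hf, BP_Ev]; simp [GP]
  choose σ a b ha hb hs hab using hroot
  have same : ∀ t, σ t 1 = σ t 0 := by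
    intro t
    by_contra hne
    have h1 := BL_single (f (Ev t 0)) (f (Ev t 1)) (σ t 0) (hs t 0)
    rw [hs t 1 _ (Ne.symm hne), hs t 1 _ (Ne.symm hne), ← BW_BL, hf, BP_Ev] at h1
    simp [GP] at h1
  have inj : Function.Injective (fun t => σ t 0) := by
    intro s t hst
    by_contra hne
    simp only at hst
    have h1 := BL_single (f (Ev s 0)) (f (Ev t 0)) (σ s 0) (hs s 0)
    rw [← BW_BL, hf, BP_Ev, ha s 0, hb s 0, hst, ha t 0, hb t 0] at h1
    simp [GP, hne] at h1
    have e1 := hab s 0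
    have e2 := hab t 0
    have h2 : 2 * a s 0 * a t 0 - a s 0 * b t 0 - b s 0 * a t 0 + 2 * b s 0 * b t 0 = 0 := by
      exact_mod_cast h1.symm
    have key : 3 * (a s 0 * b t 0 - b s 0 * a t 0) ^ 2 = 4 := by
      linear_combination (4 * (a t 0 ^ 2 - a t 0 * b t 0 + b t 0 ^ 2)) * e1 + 4 * e2 -
        (2 * a s 0 * a t 0 - a s 0 * b t 0 - b s 0 * a t 0 + 2 * b s 0 * b t 0) * h2
    omega
  have hcard : (Finset.univ \ Finset.univ.image (fun t => σ t 0)).card = 3 := by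
    rw [Finset.card_sdiff_of_subset (Finset.subset_univ _), Finset.card_image_of_injective _ inj]
    simp [F3]
  let e := (Finset.univ \ Finset.univ.image (fun t => σ t 0)).equivFinOfCardEq hcard
  refine ⟨fun i => (e.symm i : Fin 12), ?_, ?_⟩
  · intro i j hij
    exact e.symm.injective (Subtype.ext hij)
  · intro x i k
    have hm := (e.symm i).2
    simp only [Finset.mem_sdiff, Finset.mem_univ, true_and, Finset.mem_image, not_exists] at hm
    rw [decompV x, map_sum, Finset.sum_apply]
    refine Finset.sum_eq_zero fun p _ => ?_
    have hz : f (Ev p.1 p.2) ((e.symm i : Fin 12), k) = 0 := by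
      apply hs
      have : p.2 = 0 ∨ p.2 = 1 := by omega
      rcases this with h | h <;> rw [h]
      · exact fun h' => hm _ h'.symm
      · rw [same]; exact fun h' => hm _ h'.symm
    rw [map_smul, Pi.smul_apply, hz, smul_zero]

structure Fr (f : VP →ₗ[ℚ] WN) (α : Fin 3 → Fin 12) : Prop where
  iso : ∀ x y, BL (f x) (f y) = -BP x y
  into : ∀ x ∈ Plat, f x ∈ NL
  inj : ∀ x, f x = 0 → x = 0
  prim : ∀ x, f x ∈ NL → x ∈ Plat
  ainj : Function.Injective α
  van : ∀ x i k, f x (α i, k) = 0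

lemma BP_nondeg (x : VP) (h : BP x x = 0) : x = 0 := by
  rw [BP_eq, neg_eq_zero, Finset.sum_eq_zero_iff_of_nonneg] at h
  · ext ⟨t, k⟩
    have ht := h t (Finset.mem_univ _)
    have h0 : x (t,0) ^ 2 ≤ 0 := by
      nlinarith [sq_nonneg (x (t,0) - 2 * x (t,1)), sq_nonneg (x (t,0))]
    have h1 : x (t,1) ^ 2 ≤ 0 := by
      nlinarith [sq_nonneg (2 * x (t,0) - x (t,1)), sq_nonneg (x (t,1))]
    have : k = 0 ∨ k = 1 := by omega
    rcases this with rfl | rfl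
    · exact pow_eq_zero_iff (two_ne_zero) |>.1 (le_antisymm h0 (sq_nonneg _))
    · exact pow_eq_zero_iff (two_ne_zero) |>.1 (le_antisymm h1 (sq_nonneg _))
  · intro t _
    nlinarith [sq_nonneg (x (t,0) - x (t,1)), sq_nonneg (x (t,0)), sq_nonneg (x (t,1))]

lemma mkFr (f : VP →ₗ[ℚ] WN) (hf : ∀ x y : VP, BW (f x) (f y) = -BP x y)
    (hfN : Submodule.map (f.restrictScalars ℤ) Plat ≤ NL)
    (hfprim : Submodule.map (f.restrictScalars ℤ) Plat =
      (Submodule.span ℚ ((Submodule.map (f.restrictScalars ℤ) Plat : Set WN))).restrictScalars ℤ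
        ⊓ NL) : ∃ α, Fr f α := by
  obtain ⟨α, h1, h2⟩ := exists_alpha f hf hfN
  have inj : ∀ x, f x = 0 → x = 0 := by
    intro x hx
    have := hf x x
    rw [hx, BW_BL] at this
    simp at this
    exact BP_nondeg x this
  refine ⟨α, hf, fun x hx => hfN ⟨x, hx, rfl⟩, inj, ?_, h1, h2⟩
  intro x hx
  have : f x ∈ Submodule.map (f.restrictScalars ℤ) Plat := by
    rw [hfprim]
    refine ⟨?_, hx⟩
    change f x ∈ Submodule.span ℚ ((Submodule.map (f.restrictScalars ℤ) Plat : Set WN))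
    rw [decompV x, map_sum]
    refine Submodule.sum_mem _ fun p _ => ?_
    rw [map_smul]
    exact Submodule.smul_mem _ _ (Submodule.subset_span ⟨_, Ev_mem p.1 p.2, rfl⟩)
  obtain ⟨x', hx', he⟩ := this
  have : x' - x = 0 := inj _ (by rw [map_sub]; exact sub_eq_zero.2 he)
  rw [← sub_eq_zero.1 this]
  exact hx'

abbrev X3 : Type := Fin 3 × Fin 2 → ℚ

def inc (α : Fin 3 → Fin 12) (s : Fin 3 → ℚ) : X3 →ₗ[ℚ] WN :=
  Fintype.linearCombination ℚ (fun p : Fin 3 × Fin 2 => s p.1 • Et (α p.1) p.2)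

lemma inc_eq (α : Fin 3 → Fin 12) (s : Fin 3 → ℚ) (y : X3) : inc α s y =
    ∑ i, (y (i,0) • s i • Et (α i) 0 + y (i,1) • s i • Et (α i) 1) := by
  simp [inc, Fintype.linearCombination_apply, Fintype.sum_prod_type, Fin.sum_univ_two]

lemma inc_apply (α : Fin 3 → Fin 12) (hα : Function.Injective α) (s : Fin 3 → ℚ) (y : X3)
    (i : Fin 3) (k : Fin 2) : inc α s y (α i, k) = s i * y (i,k) := by
  rw [inc_eq, Finset.sum_apply, Finset.sum_eq_single i]
  · have : k = 0 ∨ k = 1 := by omega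
    rcases this with rfl | rfl <;> simp [Et, mul_comm]
  · intro b _ hb
    have : α i ≠ α b := fun h => hb (hα h).symm
    simp [Et, this]
  · simp

def FF (f : VP →ₗ[ℚ] WN) (α : Fin 3 → Fin 12) (s : Fin 3 → ℚ) : (VP × X3) →ₗ[ℚ] WN :=
  f.coprod (inc α s)

lemma FF_apply (f : VP →ₗ[ℚ] WN) (α : Fin 3 → Fin 12) (s : Fin 3 → ℚ) (x : VP) (y : X3) :
    FF f α s (x, y) = f x + inc α s y := rfl

lemma FF_inj {f : VP →ₗ[ℚ] WN} {α : Fin 3 → Fin 12} (h : Fr f α) (s : Fin 3 → ℚ)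
    (hs : ∀ i, s i * s i = 1) : Function.Injective (FF f α s) := by
  rw [injective_iff_map_eq_zero]
  rintro ⟨x, y⟩ hxy
  rw [FF_apply] at hxy
  have hy : y = 0 := by
    ext ⟨i, k⟩
    have := congrFun hxy (α i, k)
    rw [Pi.add_apply, h.van, inc_apply α h.ainj] at this
    have h2 : s i * (s i * y (i,k)) = 0 := by simp at this; simp [this]
    rw [← mul_assoc, hs, one_mul] at h2
    exact h2
  subst hy
  rw [map_zero, add_zero] at hxy
  rw [h.inj x hxy]; rfl

def FE {f : VP →ₗ[ℚ] WN} {α : Fin 3 → Fin 12} (h : Fr f α) (s : Fin 3 → ℚ)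
    (hs : ∀ i, s i * s i = 1) : (VP × X3) ≃ₗ[ℚ] WN :=
  LinearEquiv.ofInjectiveOfFinrankEq (FF f α s) (FF_inj h s hs) (by simp [F3])

lemma FE_apply {f : VP →ₗ[ℚ] WN} {α : Fin 3 → Fin 12} (h : Fr f α) (s : Fin 3 → ℚ)
    (hs : ∀ i, s i * s i = 1) (x : VP) (y : X3) : FE h s hs (x, y) = f x + inc α s y := rfl

def B3 (y y' : X3) : ℚ := ∑ i, (y' (i,0) * (2 * y (i,0) - y (i,1)) + y' (i,1) * (2 * y (i,1) - y (i,0)))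

lemma FF_iso {f : VP →ₗ[ℚ] WN} {α : Fin 3 → Fin 12} (h : Fr f α) (s : Fin 3 → ℚ)
    (hs : ∀ i, s i * s i = 1) (p q : VP × X3) :
    BL (FF f α s p) (FF f α s q) = -BP p.1 q.1 + B3 p.2 q.2 := by
  obtain ⟨x, y⟩ := p
  obtain ⟨x', y'⟩ := q
  have key : ∀ x y y', BL (FF f α s (x, y)) (inc α s y') = B3 y y' := by
    intro x y y'
    rw [inc_eq, map_sum]
    refine Finset.sum_congr rfl fun i _ => ?_
    simp only [map_add, map_smul, BL_Et0, BL_Et1]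
    simp only [FF_apply, Pi.add_apply, h.van,
      inc_apply α h.ainj, smul_eq_mul, zero_add]
    linear_combination (y' (i,0) * (2 * y (i,0) - y (i,1)) + y' (i,1) * (2 * y (i,1) - y (i,0))) * hs i
  have k0 : BL (inc α s y) (f x') = 0 := by
    have := key x' 0 y
    rw [FF_apply, map_zero, add_zero] at this
    rw [BL_comm, this]; simp [B3]
  rw [FF_apply f α s x' y', map_add, key, FF_apply, map_add, LinearMap.add_apply, h.iso, k0, add_zero]

lemma exists_x {f : VP →ₗ[ℚ] WN} {α : Fin 3 → Fin 12} (h : Fr f α) (v : WN)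
    (hv : ∀ i k, v (α i, k) = 0) : ∃ x, f x = v := by
  obtain ⟨⟨x, y⟩, hxy⟩ := (FE h 1 (by simp)).surjective v
  rw [FE_apply] at hxy
  have hy : y = 0 := by
    ext ⟨i, k⟩
    have := congrFun hxy (α i, k)
    rw [Pi.add_apply, h.van, inc_apply α h.ainj, hv] at this
    simpa using this
  subst hy
  exact ⟨x, by simpa using hxy⟩

lemma fin3a : ∀ i : Fin 3, i ≠ i + 1 := by decide
lemma fin3b : ∀ i : Fin 3, i ≠ i + 2 := by decide
lemma fin3c : ∀ i j : Fin 3, j = i ∨ j = i + 1 ∨ j = i + 2 := by decide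

lemma exists_p {f : VP →ₗ[ℚ] WN} {α : Fin 3 → Fin 12} (h : Fr f α) (i : Fin 3) :
    ∃ p, f p + eps (α i) ∈ NL := by
  obtain ⟨m, hm, h1, h2, h3⟩ := code_glue (α i) (α (i+1)) (α (i+2))
    (fun e => fin3a i (h.ainj e))
    (fun e => fin3b i (h.ainj e))
  have hall : ∀ j, m (α j) = if i = j then 1 else 0 := by
    intro j
    have : j = i ∨ j = i + 1 ∨ j = i + 2 := fin3c i j
    rcases this with rfl | rfl | rfl
    · simp [h1]
    · rw [h2, if_neg (fin3a i)]
    · rw [h3, if_neg (fin3b i)]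
  have hv : (∑ j, (m j : ℚ) • eps j) ∈ NL := by
    refine mem_of_coord _ ⟨m, m, hm, fun j => eps_sum0 _ j, fun j => ?_⟩
    rw [eps_sum1]; ring
  obtain ⟨p, hp⟩ := exists_x h ((∑ j, (m j : ℚ) • eps j) - eps (α i)) (by
    intro j k
    have : k = 0 ∨ k = 1 := by omega
    rcases this with rfl | rfl
    · rw [Pi.sub_apply, eps_sum0, eps0, hall]
      by_cases e : i = j
      · simp [e]
      · simp [e, h.ainj.ne e]
    · rw [Pi.sub_apply, eps_sum1, eps1, hall]
      by_cases e : i = j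
      · simp [e]
      · simp [e, h.ainj.ne e])
  exact ⟨p, by rw [hp, sub_add_cancel]; exact hv⟩

lemma N_decomp {f : VP →ₗ[ℚ] WN} {α : Fin 3 → Fin 12} (h : Fr f α) (p : Fin 3 → VP)
    (hp : ∀ i, f (p i) + eps (α i) ∈ NL) (v : WN) (hv : v ∈ NL) :
    ∃ (z c : Fin 3 → ℤ) (x : VP), x ∈ Plat ∧
      v = (∑ i, (z i : ℚ) • (f (p i) + eps (α i))) + (∑ i, (c i : ℚ) • Et (α i) 1) + f x := by
  obtain ⟨m, n, hm, h0, h1⟩ := coord_of_mem v hv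
  obtain ⟨x, hx⟩ := exists_x h (v - (∑ i, (m (α i) : ℚ) • (f (p i) + eps (α i)))
      - (∑ i, ((n (α i) - m (α i) : ℤ) : ℚ) • Et (α i) 1)) (by
    intro j k
    have e : ∀ i, (α i = α j) = (i = j) := fun i => propext h.ainj.eq_iff
    have e' : ∀ i, (α j = α i) = (j = i) := fun i => propext h.ainj.eq_iff
    have : k = 0 ∨ k = 1 := by omega
    rcases this with rfl | rfl
    · simp [Finset.sum_apply, h.van, eps0, e, e', h0, Et, Pi.single_apply]; ring
    · simp [Finset.sum_apply, h.van, eps1, e, e', h1, Et, Pi.single_apply]; ring)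
  refine ⟨fun i => m (α i), fun i => n (α i) - m (α i), x, h.prim x ?_, ?_⟩
  · rw [hx]
    refine Submodule.sub_mem _ (Submodule.sub_mem _ hv ?_) ?_
    · exact Submodule.sum_mem _ fun i _ => zq_mem (hp i) _
    · exact Submodule.sum_mem _ fun i _ => zq_mem (Et_mem _ _) _
  · rw [hx]; abel

lemma BL_f_eps {f : VP →ₗ[ℚ] WN} {α : Fin 3 → Fin 12} (h : Fr f α) (x : VP) (i : Fin 3) :
    BL (f x) (eps (α i)) = 0 := by rw [BL_eps, h.van]

lemma BL_eps_eps {α : Fin 3 → Fin 12} (h : Function.Injective α) (i j : Fin 3) :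
    BL (eps (α i)) (eps (α j)) = if i = j then 2 / 3 else 0 := by
  rw [BL_eps, eps1]; simp [h.eq_iff]

lemma EtV_mem (j : Fin 12) : EtV j ∈ NL :=
  Submodule.add_mem _ (Et_mem _ _) (Submodule.smul_of_tower_mem _ 2 (Et_mem _ _))

lemma three_eps (j : Fin 12) : (3 : ℚ) • eps j = EtV j := by
  rw [eps, smul_smul]; norm_num

lemma BL_ext {f : VP →ₗ[ℚ] WN} {α : Fin 3 → Fin 12} (h : Fr f α) (x y : VP) (z c : Fin 3 → ℚ) :
    BL (f x + ∑ j, z j • eps (α j)) (f y + ∑ j, c j • eps (α j)) =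
      -BP x y + 2 / 3 * ∑ j, z j * c j := by
  have e1 : ∀ x (c : Fin 3 → ℚ), BL (f x) (∑ j, c j • eps (α j)) = 0 := by
    intro x c
    rw [map_sum]
    exact Finset.sum_eq_zero fun j _ => by rw [map_smul, BL_f_eps h, smul_zero]
  have e2 : BL (∑ j, z j • eps (α j)) (∑ j, c j • eps (α j)) = 2 / 3 * ∑ j, z j * c j := by
    simp only [map_sum, LinearMap.sum_apply, map_smul, LinearMap.smul_apply, BL_eps_eps h.ainj,
      smul_eq_mul, mul_ite, mul_zero, Finset.sum_ite_eq, Finset.sum_ite_eq', Finset.mem_univ, if_true,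
      Finset.mul_sum]
    exact Finset.sum_congr rfl fun j _ => by ring
  rw [map_add, map_add, LinearMap.add_apply, LinearMap.add_apply, h.iso, e1, e2,
    BL_comm _ (f y), e1]
  ring

lemma single_ext (α : Fin 3 → Fin 12) (i : Fin 3) :
    eps (α i) = ∑ j, (Pi.single i 1 : Fin 3 → ℚ) j • eps (α j) := by
  simp [Pi.single_apply]

lemma exists_z {g : VP →ₗ[ℚ] WN} {β : Fin 3 → Fin 12} (h : Fr g β) (p : VP)
    (hp : ∀ x ∈ Plat, IsI (BP p x)) :
    ∃ z : Fin 3 → ℤ, g p + ∑ j, (z j : ℚ) • eps (β j) ∈ NL := by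
  choose q hq using exists_p h
  have h3 : ∀ j, (3 : ℚ) • q j ∈ Plat := by
    intro j
    apply h.prim
    have : g ((3 : ℚ) • q j) = ((3 : ℤ) : ℚ) • (g (q j) + eps (β j)) - EtV (β j) := by
      rw [map_smul, smul_add, ← three_eps]; push_cast; abel
    rw [this]
    exact Submodule.sub_mem _ (zq_mem (hq j) 3) (EtV_mem _)
  choose a ha using fun j => hp _ (h3 j)
  have ha' : ∀ j, BP p (q j) = a j / 3 := by
    intro j
    have h1 := h.iso p ((3 : ℚ) • q j)
    rw [map_smul, map_smul, h.iso, ha, smul_eq_mul] at h1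
    linarith
  refine ⟨fun j => -a j, mem_of_dual _ ?_⟩
  intro w hw
  obtain ⟨z, c, x, hx, rfl⟩ := N_decomp h q hq w hw
  rw [map_add, map_add, map_sum, map_sum]
  refine IsI.add (IsI.add (IsI.sum _ _ fun j _ => ?_) (IsI.sum _ _ fun j _ => ?_)) ?_
  · rw [map_smul, smul_eq_mul]
    refine IsI.zmul _ ?_
    rw [single_ext β j, BL_ext h, ha']
    refine ⟨-a j, ?_⟩
    simp [Pi.single_apply]; ring
  · rw [map_smul, smul_eq_mul, BL_Et1]
    refine IsI.zmul _ ⟨-a j, ?_⟩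
    simp [Finset.sum_apply, h.van, eps0, eps1, h.ainj.eq_iff]
    ring
  · have := BL_ext h p x (fun j => ((-a j : ℤ) : ℚ)) 0
    simp only [Pi.zero_apply, zero_smul, Finset.sum_const_zero, add_zero, mul_zero] at this
    rw [this]
    exact (hp x hx).neg

lemma row_dec : ∀ r : Fin 3 → ZMod 3, ∑ j, r j * r j = 1 →
    ∃ j, r = Pi.single j 1 ∨ r = Pi.single j (-1) := by
  decide +kernel

lemma exists_perm (z : Fin 3 → Fin 3 → ℤ)
    (hz : ∀ i k, (3 : ℤ) ∣ (∑ j, z i j * z k j) - if i = k then 1 else 0) :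
    ∃ (τ : Fin 3 → Fin 3) (s : Fin 3 → ℤ), Function.Injective τ ∧ (∀ i, s i * s i = 1) ∧
      ∀ i j, (3 : ℤ) ∣ z i j - (Pi.single (τ i) (s i) : Fin 3 → ℤ) j := by
  have hz' : ∀ i k, ∑ j, (z i j : ZMod 3) * (z k j : ZMod 3) = if i = k then 1 else 0 := by
    intro i k
    have := (ZMod.intCast_zmod_eq_zero_iff_dvd _ 3).2 (by exact_mod_cast hz i k)
    push_cast at this
    exact sub_eq_zero.1 this
  have hrow : ∀ i, ∃ (j : Fin 3) (s : ℤ), s * s = 1 ∧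
      (fun l => (z i l : ZMod 3)) = Pi.single j (s : ZMod 3) := by
    intro i
    obtain ⟨j, h | h⟩ := row_dec (fun l => (z i l : ZMod 3)) (by rw [hz' i i]; simp)
    · exact ⟨j, 1, by norm_num, by simpa using h⟩
    · exact ⟨j, -1, by norm_num, by simpa using h⟩
  choose τ s hs hr using hrow
  refine ⟨τ, s, ?_, hs, ?_⟩
  · intro i k hik
    by_contra hne
    have h1 := hz' i k
    rw [if_neg hne] at h1
    have e : ∀ i j, (z i j : ZMod 3) = (Pi.single (τ i) (s i : ZMod 3) : Fin 3 → ZMod 3) j :=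
      fun i j => congrFun (hr i) j
    simp only [e, hik, Pi.single_apply] at h1
    simp at h1
    have h2 : ∀ i, ((s i : ℤ) : ZMod 3) * (s i : ZMod 3) = 1 := fun i => by
      have := congrArg (Int.cast : ℤ → ZMod 3) (hs i)
      push_cast at this
      exact this
    rcases h1 with h1 | h1
    · have := h2 i; rw [h1] at this; exact absurd this (by decide)
    · have := h2 k; rw [h1] at this; exact absurd this (by decide)
  · intro i j
    have h1 := congrFun (hr i) j
    have : ((z i j - (Pi.single (τ i) (s i) : Fin 3 → ℤ) j : ℤ) : ZMod 3) = 0 := by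
      push_cast
      rw [sub_eq_zero]
      rw [h1]
      simp only [Pi.single_apply]
      split_ifs <;> simp
    exact_mod_cast (ZMod.intCast_zmod_eq_zero_iff_dvd _ 3).1 this

lemma FE_symm_f {f : VP →ₗ[ℚ] WN} {α : Fin 3 → Fin 12} (h : Fr f α) (s : Fin 3 → ℚ)
    (hs : ∀ i, s i * s i = 1) (x : VP) : (FE h s hs).symm (f x) = (x, 0) := by
  rw [LinearEquiv.symm_apply_eq, FE_apply, map_zero, add_zero]

lemma inc_single (α : Fin 3 → Fin 12) (s : Fin 3 → ℚ) (i : Fin 3) (k : Fin 2) :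
    inc α s (Pi.single (i,k) 1) = s i • Et (α i) k := by
  simp [inc]

lemma FE_symm_Et {f : VP →ₗ[ℚ] WN} {α : Fin 3 → Fin 12} (h : Fr f α)
    (hs : ∀ i, (1 : Fin 3 → ℚ) i * (1 : Fin 3 → ℚ) i = 1) (i : Fin 3) (k : Fin 2) :
    (FE h 1 hs).symm (Et (α i) k) = (0, Pi.single (i,k) 1) := by
  rw [LinearEquiv.symm_apply_eq, FE_apply, map_zero, zero_add, inc_single]; simp

theorem statement10 (f g : VP →ₗ[ℚ] WN)
    -- f and g are isometric embeddings of P with its form negated ...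
    (hf : ∀ x y : VP, BW (f x) (f y) = -BP x y)
    (hg : ∀ x y : VP, BW (g x) (g y) = -BP x y)
    -- ... mapping P into N ...
    (hfN : Submodule.map (f.restrictScalars ℤ) Plat ≤ NL)
    (hgN : Submodule.map (g.restrictScalars ℤ) Plat ≤ NL)
    -- ... with primitive images
    (hfprim : Submodule.map (f.restrictScalars ℤ) Plat =
      (Submodule.span ℚ ((Submodule.map (f.restrictScalars ℤ) Plat : Set WN))).restrictScalars ℤ
        ⊓ NL)
    (hgprim : Submodule.map (g.restrictScalars ℤ) Plat =
      (Submodule.span ℚ ((Submodule.map (g.restrictScalars ℤ) Plat : Set WN))).restrictScalars ℤ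
        ⊓ NL) :
    -- then there is an automorphism Φ of N with Φ ∘ f = g on P
    ∃ Φ : WN ≃ₗ[ℚ] WN,
      (∀ v w : WN, BW (Φ v) (Φ w) = BW v w) ∧
      ((fun v => Φ v) '' NL = NL) ∧
      (∀ x ∈ Plat, Φ (f x) = g x) := by
  obtain ⟨α, hF⟩ := mkFr f hf hfN hfprim
  obtain ⟨β, hG⟩ := mkFr g hg hgN hgprim
  choose p hp using exists_p hF
  have hpd : ∀ i, ∀ x ∈ Plat, IsI (BP (p i) x) := by
    intro i x hx
    have h1 := NL_int _ _ (hp i) (hF.into x hx)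
    rw [map_add, LinearMap.add_apply, hF.iso, BL_comm (eps _), BL_f_eps hF, add_zero] at h1
    simpa using h1.neg
  choose z hz using fun i => exists_z hG (p i) (hpd i)
  obtain ⟨τ, s, hτ, hs, hzs⟩ := exists_perm z (by
    intro i k
    have h1 := NL_int _ _ (hp i) (hp k)
    rw [single_ext α i, single_ext α k, BL_ext hF] at h1
    have h2 := NL_int _ _ (hz i) (hz k)
    rw [BL_ext hG] at h2
    obtain ⟨c, hc⟩ := h2.sub h1
    have e : (∑ j, (Pi.single i 1 : Fin 3 → ℚ) j * (Pi.single k 1 : Fin 3 → ℚ) j)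
        = ((if i = k then 1 else 0 : ℤ) : ℚ) := by
      simp [Pi.single_apply, eq_comm]
    rw [e] at hc
    have hc2 : 2 * ((∑ j, z i j * z k j) - if i = k then 1 else 0) = 3 * c := by
      have : (2 : ℚ) * ((∑ j, (z i j : ℚ) * (z k j : ℚ)) - ((if i = k then 1 else 0 : ℤ) : ℚ))
        = 3 * c := by linarith
      exact_mod_cast this
    omega)
  have hG' : Fr g (β ∘ τ) :=
    ⟨hG.iso, hG.into, hG.inj, hG.prim, hG.ainj.comp hτ, fun x i k => hG.van x (τ i) k⟩
  have hgp : ∀ i, g (p i) + (s i : ℚ) • eps (β (τ i)) ∈ NL := by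
    intro i
    choose d hd using hzs i
    have e : g (p i) + (s i : ℚ) • eps (β (τ i)) =
        (g (p i) + ∑ j, (z i j : ℚ) • eps (β j)) - ∑ j, (d j : ℚ) • EtV (β j) := by
      have e1 : (s i : ℚ) • eps (β (τ i)) =
          ∑ j, (((Pi.single (τ i) (s i) : Fin 3 → ℤ) j : ℤ) : ℚ) • eps (β j) := by
        rw [Finset.sum_eq_single (τ i)]
        · simp
        · intro b _ hb; simp [Pi.single_apply, hb]
        · simp
      rw [e1, add_sub_assoc, ← Finset.sum_sub_distrib]
      congr 1
      refine Finset.sum_congr rfl fun j _ => ?_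
      rw [← three_eps, smul_smul, ← sub_smul]
      congr 1
      have := hd j
      have h2 : (((Pi.single (τ i) (s i) : Fin 3 → ℤ) j : ℤ) : ℚ) = ((z i j - 3 * d j : ℤ) : ℚ) := by
        congr 1; omega
      rw [h2]; push_cast; ring
    rw [e]
    exact Submodule.sub_mem _ (hz i) (Submodule.sum_mem _ fun j _ => zq_mem (EtV_mem _) _)
  have hs1 : ∀ i, (1 : Fin 3 → ℚ) i * (1 : Fin 3 → ℚ) i = 1 := by simp
  have hs2 : ∀ i, (fun i => (s i : ℚ)) i * (fun i => (s i : ℚ)) i = 1 := fun i => by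
    have : (s i : ℚ) * (s i : ℚ) = 1 := by exact_mod_cast hs i
    exact this
  let Φ : WN ≃ₗ[ℚ] WN := (FE hF 1 hs1).symm.trans (FE hG' _ hs2)
  have Φf : ∀ x, Φ (f x) = g x := by
    intro x
    change FE hG' _ hs2 ((FE hF 1 hs1).symm (f x)) = _
    rw [FE_symm_f, FE_apply, map_zero, add_zero]
  have ΦE : ∀ i k, Φ (Et (α i) k) = (s i : ℚ) • Et (β (τ i)) k := by
    intro i k
    change FE hG' _ hs2 ((FE hF 1 hs1).symm (Et (α i) k)) = _
    rw [FE_symm_Et, FE_apply, map_zero, zero_add, inc_single]; rfl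
  have Φe : ∀ i, Φ (eps (α i)) = (s i : ℚ) • eps (β (τ i)) := by
    intro i
    simp only [eps, EtV, map_smul, map_add, map_nsmul, ΦE]
    module
  have Φiso : ∀ v w, BL (Φ v) (Φ w) = BL v w := by
    intro v w
    obtain ⟨v, rfl⟩ := (FE hF 1 hs1).surjective v
    obtain ⟨w, rfl⟩ := (FE hF 1 hs1).surjective w
    have e : ∀ u, Φ (FE hF 1 hs1 u) = FF g (β ∘ τ) (fun i => (s i : ℚ)) u := by
      intro u
      change FE hG' _ hs2 ((FE hF 1 hs1).symm (FE hF 1 hs1 u)) = _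
      rw [LinearEquiv.symm_apply_apply]; rfl
    rw [e, e, FF_iso hG' _ hs2]
    exact (FF_iso hF 1 hs1 v w).symm
  have ΦN : ∀ v ∈ NL, Φ v ∈ NL := by
    intro v hv
    obtain ⟨z, c, x, hx, rfl⟩ := N_decomp hF p hp v hv
    rw [map_add, map_add, map_sum, map_sum, Φf]
    refine Submodule.add_mem _ (Submodule.add_mem _ (Submodule.sum_mem _ fun i _ => ?_)
      (Submodule.sum_mem _ fun i _ => ?_)) (hG.into x hx)
    · rw [map_smul, map_add, Φf, Φe]; exact zq_mem (hgp i) _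
    · rw [map_smul, ΦE]; exact zq_mem (zq_mem (Et_mem _ _) _) _
  refine ⟨Φ, Φiso, ?_, fun x _ => Φf x⟩
  apply Set.Subset.antisymm
  · rintro _ ⟨v, hv, rfl⟩
    exact ΦN v hv
  · intro v hv
    refine ⟨Φ.symm v, mem_of_dual _ fun w hw => ?_, Φ.apply_symm_apply v⟩
    rw [← Φiso, Φ.apply_symm_apply]
    exact NL_int _ _ hv (ΦN w hw)
end
end
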